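/- Assume V is real-valued, θ₀, θ_R ∈ [0,2π), θ₀', θ_R' ∈ (0,2π)\{π}, and z ∈ ℂ\[e₀,∞). Then the symmetrized product closure((H_{θ₀',θ_R'} − zI)^{1/2}(H_{θ₀,θ_R} − zI)^{-1}(H_{θ₀',θ_R'} − zI)^{1/2}) is a bounded operator on L²((0,R);dx), equal to [(H_{θ₀',θ_R'} − zI)^{1/2}(H_{θ₀,θ_R} − zI)^{-1/2}] [(H_{θ₀',θ_R'} − z̄I)^{1/2}(H_{θ₀,θ_R} − z̄I)^{-1/2}]*, and its difference from the identity, −closure((H_{θ₀',θ_R'} − zI)^{1/2}[(H_{θ₀',θ_R'} − zI)^{-1} − (H_{θ₀,θ_R} − zI)^{-1}](H_{θ₀',θ_R'} − zI)^{1/2}), is a finite-rank operator of rank at most two (in particular trace class). -/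

import Mathlib

open MeasureTheory Filter
open scoped InnerProductSpace

noncomputable section
open scoped Classical


variable {H : Type*} [NormedAddCommGroup H] [InnerProductSpace ℂ H] [CompleteSpace H]

/-- `T` is the (bounded, everywhere defined) inverse of `A - z·I`. -/
def IsResolvent (A : H →ₗ.[ℂ] H) (z : ℂ) (T : H →L[ℂ] H) : Prop :=
  (∀ x : H, ∃ hx : T x ∈ A.domain, A ⟨T x, hx⟩ - z • T x = x) ∧
  ∀ u : A.domain, T (A u - z • (u : H)) = (u : H)

/-- The resolvent set of an unbounded operator. -/
def resolventSetP (A : H →ₗ.[ℂ] H) : Set ℂ := {z | ∃ T, IsResolvent A z T}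

/-- The spectrum of an unbounded operator. -/
def specP (A : H →ₗ.[ℂ] H) : Set ℂ := (resolventSetP A)ᶜ

/-- The resolvent `(A - z·I)⁻¹` (junk value `0` off the resolvent set). -/
def res (A : H →ₗ.[ℂ] H) (z : ℂ) : H →L[ℂ] H :=
  if h : ∃ T, IsResolvent A z T then h.choose else 0

/-- The operator `A + t·I` (same domain). -/
def shiftP (A : H →ₗ.[ℂ] H) (t : ℂ) : H →ₗ.[ℂ] H :=
  ⟨A.domain, A.toFun + t • A.domain.subtype⟩

/-- `A` is of positive type: `(-∞,0] ⊆ ρ(A)` and `sup_{t ≥ 0} ‖(1+t)(A+t)⁻¹‖ < ∞`. -/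
def IsPositiveTypeP (A : H →ₗ.[ℂ] H) : Prop :=
  (∀ x : ℝ, x ≤ 0 → (x : ℂ) ∈ resolventSetP A) ∧
  ∃ M : ℝ, ∀ t : ℝ, 0 ≤ t → (1 + t) * ‖res A (-(t : ℂ))‖ ≤ M

/-- The open sector of half-opening angle `ω` about the positive reals
(`(0,∞)` for `ω = 0`). -/
def sectorS (ω : ℝ) : Set ℂ :=
  if ω = 0 then (fun x : ℝ => (x : ℂ)) '' Set.Ioi 0
  else {z : ℂ | z ≠ 0 ∧ |Complex.arg z| < ω}

/-- `A` is sectorial of angle `ω`. -/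
def IsSectorialP (A : H →ₗ.[ℂ] H) (ω : ℝ) : Prop :=
  specP A ⊆ closure (sectorS ω) ∧
  ∀ ω' : ℝ, ω < ω' → ω' < Real.pi →
    ∃ M : ℝ, ∀ z ∈ (closure (sectorS ω'))ᶜ, ‖z‖ * ‖res A z‖ ≤ M

/-- The shifted sector `-t₀ + S_ω`. -/
def shiftedSector (t0 ω : ℝ) : Set ℂ := (fun w => -(t0 : ℂ) + w) '' sectorS ω

/-- The region `ℂ \ closure (-t₀ + S_ω)`. -/
def offSector (t0 ω : ℝ) : Set ℂ := (closure (shiftedSector t0 ω))ᶜ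

/-- The bounded operator `(A - z·I)^{-1/2}`, defined by the Balakrishnan-type formula
`(1/π) ∫₀^∞ t^{-1/2} (A + (t - z)·I)⁻¹ dt`. -/
def negSqrt (A : H →ₗ.[ℂ] H) (z : ℂ) : H →L[ℂ] H :=
  ((Real.pi : ℂ))⁻¹ • ∫ t in Set.Ioi (0 : ℝ), ((Real.sqrt t : ℂ))⁻¹ • res A (z - t)

/-- Trace-class (nuclear) bounded operators, characterized by
`sup { ∑ |⟨eᵢ, T fᵢ⟩| : (eᵢ), (fᵢ) finite orthonormal families } < ∞`. -/
def IsTraceClass (T : H →L[ℂ] H) : Prop :=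
  ∃ C : ℝ, ∀ (n : ℕ) (e f : Fin n → H), Orthonormal ℂ e → Orthonormal ℂ f →
    ∑ i, ‖⟪e i, T (f i)⟫_ℂ‖ ≤ C

/-- The trace norm `‖T‖₁`. -/
def traceNorm (T : H →L[ℂ] H) : ℝ :=
  sSup {s : ℝ | ∃ (n : ℕ) (e f : Fin n → H), Orthonormal ℂ e ∧ Orthonormal ℂ f ∧
    s = ∑ i, ‖⟪e i, T (f i)⟫_ℂ‖}

/-- The trace of a (trace-class) operator, computed in the Hilbert basis `b`. -/
def traceH (b : HilbertBasis ℕ ℂ H) (T : H →L[ℂ] H) : ℂ :=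
  ∑' n, ⟪(b n : H), T (b n)⟫_ℂ

/-- The Fredholm determinant `det (I + T)` (for `T` trace class), computed as the limit of
finite-section determinants along the Hilbert basis `b`. -/
def detI (b : HilbertBasis ℕ ℂ H) (T : H →L[ℂ] H) : ℂ :=
  limUnder atTop fun F : Finset ℕ =>
    Matrix.det (Matrix.of fun i j : F =>
      (if (i : ℕ) = (j : ℕ) then (1 : ℂ) else 0) + ⟪(b (i : ℕ) : H), T (b (j : ℕ))⟫_ℂ)


/-! ### One-dimensional Schrödinger operators on `[0,R]` -/

/-- The underlying Hilbert space `L²((0,R); dx)`. -/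
abbrev SchSp (Rr : ℝ) :=
  MeasureTheory.Lp ℂ 2 (MeasureTheory.volume.restrict (Set.Ioo (0 : ℝ) Rr))

/-- `u` (with derivative `du`) solves `-u'' + V u = z u` on `[0,R]`, with
`u, u' ∈ AC([0,R])` (the second derivative being encoded in integrated form). -/
def SolODE (Rr : ℝ) (V : ℝ → ℂ) (z : ℂ) (u du : ℝ → ℂ) : Prop :=
  (∀ x ∈ Set.Icc (0 : ℝ) Rr, HasDerivWithinAt u (du x) (Set.Icc (0 : ℝ) Rr) x) ∧
  ∀ x ∈ Set.Icc (0 : ℝ) Rr, du x = du 0 + ∫ t in (0 : ℝ)..x, (V t - z) * u t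

/-- The boundary trace `γ_{θ₀,θ_R}(u) = (cos θ₀ u(0) + sin θ₀ u'(0),
cos θ_R u(R) - sin θ_R u'(R))`. -/
def bdryC (Rr : ℝ) (t0 tR : ℂ) (u du : ℝ → ℂ) : Fin 2 → ℂ :=
  ![Complex.cos t0 * u 0 + Complex.sin t0 * du 0,
    Complex.cos tR * u Rr - Complex.sin tR * du Rr]

/-- `g` (with derivative `dg`) is an absolutely continuous representative of `f ∈ L²`
satisfying `-g'' + V g - z g = h` (in integrated form, with `h₀` a representative of
`h ∈ L²`); i.e. `f` represents `(H - z)⁻¹ h`. -/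
def SolvesAt (Rr : ℝ) (V : ℝ → ℂ) (z : ℂ) (f h : SchSp Rr) (g dg : ℝ → ℂ) : Prop :=
  (∀ᵐ x ∂(MeasureTheory.volume.restrict (Set.Ioo (0 : ℝ) Rr)), f x = g x) ∧
  (∀ x ∈ Set.Icc (0 : ℝ) Rr, HasDerivWithinAt g (dg x) (Set.Icc (0 : ℝ) Rr) x) ∧
  ∃ h0 : ℝ → ℂ,
    (∀ᵐ x ∂(MeasureTheory.volume.restrict (Set.Ioo (0 : ℝ) Rr)), h x = h0 x) ∧
    ∀ x ∈ Set.Icc (0 : ℝ) Rr,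
      dg x = dg 0 + ∫ t in (0 : ℝ)..x, (V t * g t - z * g t - h0 t)

/-- `Hop` is the Schrödinger operator `H_{θ₀,θ_R} = -d²/dx² + V` in `L²((0,R); dx)` with
separated boundary conditions `γ_{θ₀,θ_R}(g) = 0`, characterized through its graph. -/
def IsSchrodingerOp (Rr : ℝ) (V : ℝ → ℂ) (t0 tR : ℂ)
    (Hop : SchSp Rr →ₗ.[ℂ] SchSp Rr) : Prop :=
  ∀ f h : SchSp Rr, (f, h) ∈ Hop.graph ↔
    ∃ g dg : ℝ → ℂ, SolvesAt Rr V 0 f h g dg ∧ bdryC Rr t0 tR g dg = 0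

/-- `Λ` is the boundary data map `Λ_{θ₀,θ_R}^{θ₀',θ_R'}(z)`: for every solution `u` of
`-u'' + Vu = zu`, `Λ` maps `γ_{θ₀,θ_R}(u)` to `γ_{θ₀',θ_R'}(u)`. -/
def IsBoundaryDataMap (Rr : ℝ) (V : ℝ → ℂ) (t0 tR t0' tR' : ℂ) (z : ℂ)
    (Λ : Matrix (Fin 2) (Fin 2) ℂ) : Prop :=
  ∀ u du : ℝ → ℂ, SolODE Rr V z u du →
    Λ.mulVec (bdryC Rr t0 tR u du) = bdryC Rr t0' tR' u du

/-- `G` is the map `γ_{θ₀',θ_R'} ∘ (Hop - z)⁻¹ : L²((0,R)) → ℂ²`. -/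
def IsBdryResolventMap (Rr : ℝ) (V : ℝ → ℂ) (t0' tR' : ℂ) (z : ℂ)
    (Hop : SchSp Rr →ₗ.[ℂ] SchSp Rr)
    (G : SchSp Rr →L[ℂ] EuclideanSpace ℂ (Fin 2)) : Prop :=
  ∀ (h : SchSp Rr) (g dg : ℝ → ℂ), SolvesAt Rr V z (res Hop z h) h g dg →
    ∀ i : Fin 2, G h i = bdryC Rr t0' tR' g dg i

/-- The region `ℂ \ [c, ∞)`. -/
def offCut (c : ℝ) : Set ℂ := {z : ℂ | z.im ≠ 0 ∨ z.re < c}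

/-- `N` is the family `z ↦ (Hop - z)^{-1/2}`, defined via the spectral theorem with branch
cut along `[c, ∞)` (`c = inf σ(Hop)`): analytic on `ℂ \ [c,∞)`, squaring to the resolvent,
and positive (self-adjoint) for real `z < c`. -/
def IsSqrtResFam (Rr : ℝ) (Hop : SchSp Rr →ₗ.[ℂ] SchSp Rr) (c : ℝ)
    (N : ℂ → (SchSp Rr →L[ℂ] SchSp Rr)) : Prop :=
  (∀ z ∈ offCut c, (N z).comp (N z) = res Hop z) ∧
  (∀ x : ℝ, x < c →
    (∀ v w : SchSp Rr, ⟪N (x : ℂ) v, w⟫_ℂ = ⟪v, N (x : ℂ) w⟫_ℂ) ∧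
    ∀ v : SchSp Rr, 0 ≤ (⟪v, N (x : ℂ) v⟫_ℂ).re) ∧
  DifferentiableOn ℂ N (offCut c)

/-- The infimum `e₀ = inf(σ(Hop) ∪ σ(Hop'))`. -/
def einf (Rr : ℝ) (Hop Hop' : SchSp Rr →ₗ.[ℂ] SchSp Rr) : ℝ :=
  sInf {x : ℝ | (x : ℂ) ∈ specP Hop ∪ specP Hop'}

/-- The infimum of the spectrum of a single operator. -/
def einf1 (Rr : ℝ) (Hop : SchSp Rr →ₗ.[ℂ] SchSp Rr) : ℝ :=
  sInf {x : ℝ | (x : ℂ) ∈ specP Hop}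


/-! ### Resolvents of self-adjoint operators -/

lemma isResolvent_res {A : H →ₗ.[ℂ] H} {z : ℂ} (h : z ∈ resolventSetP A) :
    IsResolvent A z (res A z) := by
  have h' : ∃ T, IsResolvent A z T := h
  rw [res, dif_pos h']
  exact h'.choose_spec

lemma res_identity {A : H →ₗ.[ℂ] H} {z w : ℂ} (hz : z ∈ resolventSetP A)
    (hw : w ∈ resolventSetP A) (x : H) :
    res A z x = res A w x + (z - w) • res A z (res A w x) := by
  obtain ⟨hx, e⟩ := (isResolvent_res hw).1 x
  have h2 := (isResolvent_res hz).2 ⟨res A w x, hx⟩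
  have e2 : A ⟨res A w x, hx⟩ = x + w • res A w x := sub_eq_iff_eq_add.1 e
  rw [e2] at h2
  simp only [map_sub, map_add, map_smul] at h2
  calc res A z x = (res A z x + w • res A z (res A w x) - z • res A z (res A w x))
        + (z - w) • res A z (res A w x) := by module
    _ = _ := by rw [h2]

lemma res_comm {A : H →ₗ.[ℂ] H} {z w : ℂ} (hz : z ∈ resolventSetP A)
    (hw : w ∈ resolventSetP A) : res A z * res A w = res A w * res A z := by
  rcases eq_or_ne z w with rfl | hne
  · rfl
  ext x
  have h1 := res_identity hz hw x
  have h2 := res_identity hw hz x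
  have h3 : (z - w) • (res A z (res A w x) - res A w (res A z x)) = 0 := by
    have : (z - w) • res A z (res A w x) = res A z x - res A w x := by
      rw [eq_sub_iff_add_eq, add_comm]; exact h1.symm
    have h' : (w - z) • res A w (res A z x) = res A w x - res A z x := by
      rw [eq_sub_iff_add_eq, add_comm]; exact h2.symm
    rw [smul_sub, this, ← neg_sub w z, neg_smul, h']
    abel
  rcases smul_eq_zero.1 h3 with h | h
  · exact absurd (sub_eq_zero.1 h) hne
  · exact sub_eq_zero.1 h

lemma res_injective {A : H →ₗ.[ℂ] H} {z : ℂ} (hz : z ∈ resolventSetP A) :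
    Function.Injective (res A z) := by
  refine (injective_iff_map_eq_zero _).2 fun x hx => ?_
  obtain ⟨h, e⟩ := (isResolvent_res hz).1 x
  have h0 : (⟨res A z x, h⟩ : A.domain) = 0 := Subtype.ext hx
  rw [h0, hx] at e
  simpa using e.symm

lemma IsSelfAdjoint.inner_apply {A : H →ₗ.[ℂ] H} (hA : IsSelfAdjoint A) (u v : A.domain) :
    ⟪A u, (v : H)⟫_ℂ = ⟪(u : H), A v⟫_ℂ := by
  have h := LinearPMap.adjoint_isFormalAdjoint (T := A) hA.dense_domain
  rw [LinearPMap.isSelfAdjoint_def.mp hA] at h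
  exact h u v

lemma IsSelfAdjoint.adjoint_res {A : H →ₗ.[ℂ] H} (hA : IsSelfAdjoint A) {z : ℂ}
    (hz : z ∈ resolventSetP A) (hz' : (starRingEnd ℂ) z ∈ resolventSetP A) :
    ContinuousLinearMap.adjoint (res A z) = res A ((starRingEnd ℂ) z) := by
  symm
  rw [ContinuousLinearMap.eq_adjoint_iff]
  intro y x
  obtain ⟨hu, eu⟩ := (isResolvent_res hz).1 x
  obtain ⟨hv, ev⟩ := (isResolvent_res hz').1 y
  have h := hA.inner_apply ⟨_, hv⟩ ⟨_, hu⟩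
  conv_lhs => rw [← eu]
  conv_rhs => rw [← ev]
  rw [inner_sub_left, inner_sub_right, h, inner_smul_left, inner_smul_right]
  simp

lemma IsSelfAdjoint.mem_resolventSetP_of_bound {A : H →ₗ.[ℂ] H} (hA : IsSelfAdjoint A) {z : ℂ}
    {δ : ℝ} (hδ : 0 < δ) (hb : ∀ u : A.domain, δ * ‖(u : H)‖ ≤ ‖A u - z • (u : H)‖)
    (hk : ∀ u : A.domain, A u = (starRingEnd ℂ) z • (u : H) → (u : H) = 0) :
    z ∈ resolventSetP A := by
  let φ : A.graph →L[ℂ] H :=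
    (ContinuousLinearMap.snd ℂ H H - z • ContinuousLinearMap.fst ℂ H H).comp A.graph.subtypeL
  have hφ : ∀ p : A.graph, φ p = p.1.2 - z • p.1.1 := fun p => rfl
  have hcl : IsClosed (A.graph : Set (H × H)) := hA.isClosed
  have : CompleteSpace A.graph := hcl.completeSpace_coe
  have key : ∀ p : A.graph, δ * ‖p.1.1‖ ≤ ‖φ p‖ := by
    rintro ⟨⟨u, v⟩, hp⟩
    obtain ⟨y, rfl, rfl⟩ := (LinearPMap.mem_graph_iff _).1 hp
    exact hb y
  have hanti : ∃ K, AntilipschitzWith K φ := by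
    refine ⟨⟨1 / δ + (1 + ‖z‖ / δ), by positivity⟩, AddMonoidHomClass.antilipschitz_of_bound φ ?_⟩
    intro p
    have h1 : ‖p.1.1‖ ≤ ‖φ p‖ / δ := by
      rw [le_div_iff₀ hδ, mul_comm]; exact key p
    have h2 : ‖p.1.2‖ ≤ ‖φ p‖ + ‖z‖ * ‖p.1.1‖ := by
      have : p.1.2 = φ p + z • p.1.1 := by rw [hφ]; abel
      rw [this, ← norm_smul]
      exact norm_add_le _ _
    have h3 : ‖p‖ = max ‖p.1.1‖ ‖p.1.2‖ := rfl
    have h4 : ‖z‖ * ‖p.1.1‖ ≤ ‖z‖ * (‖φ p‖ / δ) := by gcongr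
    have h5 : 0 ≤ ‖z‖ * (‖φ p‖ / δ) := by positivity
    have h6 : 0 ≤ ‖φ p‖ / δ := by positivity
    have h7 := norm_nonneg (φ p)
    rw [h3]
    change _ ≤ (1 / δ + (1 + ‖z‖ / δ)) * ‖φ p‖
    have e : (1 / δ + (1 + ‖z‖ / δ)) * ‖φ p‖ = ‖φ p‖ / δ + ‖φ p‖ + ‖z‖ * (‖φ p‖ / δ) := by ring
    rw [e]
    apply max_le <;> linarith
  obtain ⟨K, hK⟩ := hanti
  have hrc : IsClosed (Set.range φ) := hK.isClosed_range φ.uniformContinuous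
  have horth : (LinearMap.range φ.toLinearMap)ᗮ = ⊥ := by
    rw [Submodule.eq_bot_iff]
    intro y hy
    rw [Submodule.mem_orthogonal] at hy
    have hg : (y, (starRingEnd ℂ) z • y) ∈ A.graph := by
      have hgr := LinearPMap.adjoint_graph_eq_graph_adjoint (T := A) hA.dense_domain
      rw [LinearPMap.isSelfAdjoint_def.mp hA] at hgr
      rw [hgr, Submodule.mem_adjoint_iff]
      intro a b hab
      have := hy (φ ⟨(a, b), hab⟩) ⟨_, rfl⟩
      rw [hφ] at this
      simp only [inner_sub_left, inner_smul_left] at this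
      simpa [inner_smul_right] using this
    obtain ⟨u, hu, hu'⟩ := (LinearPMap.mem_graph_iff _).1 hg
    have hu1 : (u : H) = y := hu
    rw [← hu1]
    exact hk u (by rw [hu1]; exact hu')
  have htop : LinearMap.range φ.toLinearMap = ⊤ := by
    have : (LinearMap.range φ.toLinearMap).topologicalClosure = ⊤ :=
      Submodule.topologicalClosure_eq_top_iff.2 horth
    rwa [IsClosed.submodule_topologicalClosure_eq (by exact hrc)] at this
  have hker : LinearMap.ker φ.toLinearMap = ⊥ := LinearMap.ker_eq_bot.2 hK.injective
  let e := ContinuousLinearEquiv.ofBijective φ hker htop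
  have he : ∀ p, e p = φ p := fun p => rfl
  refine ⟨(ContinuousLinearMap.fst ℂ H H).comp
    (A.graph.subtypeL.comp (e.symm : H →L[ℂ] A.graph)), ?_, ?_⟩
  · intro x
    have h1 : e (e.symm x) = x := e.apply_symm_apply x
    rw [he, hφ] at h1
    obtain ⟨u, hu, hu'⟩ := (LinearPMap.mem_graph_iff _).1 (e.symm x).2
    have hd : (e.symm x).1.1 ∈ A.domain := hu ▸ u.2
    refine ⟨hd, ?_⟩
    have : u = ⟨_, hd⟩ := Subtype.ext hu
    rw [this] at hu'
    simp only [ContinuousLinearMap.coe_comp, Function.comp_apply] 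
    change A ⟨(e.symm x).1.1, hd⟩ - z • (e.symm x).1.1 = x
    rw [hu', h1]
  · intro u
    have : A u - z • (u : H) = e ⟨((u : H), A u), A.mem_graph u⟩ := by rw [he, hφ]
    rw [this]
    simp

lemma IsSelfAdjoint.mem_resolventSetP_of_im_ne_zero {A : H →ₗ.[ℂ] H} (hA : IsSelfAdjoint A)
    {z : ℂ} (hz : z.im ≠ 0) : z ∈ resolventSetP A := by
  have key : ∀ w : ℂ, ∀ u : A.domain, |w.im| * ‖(u : H)‖ ≤ ‖A u - w • (u : H)‖ := by
    intro w u
    rcases eq_or_ne ‖(u : H)‖ 0 with h0 | h0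
    · simp [h0]
    have hpos : 0 < ‖(u : H)‖ := lt_of_le_of_ne (norm_nonneg _) (Ne.symm h0)
    have h1 : (⟪(u : H), A u⟫_ℂ).im = 0 := by
      have := hA.inner_apply u u
      rw [← inner_conj_symm] at this
      exact Complex.conj_eq_iff_im.1 this
    have h2 : (⟪(u : H), A u - w • (u : H)⟫_ℂ).im = - (w.im * ‖(u : H)‖ ^ 2) := by
      rw [inner_sub_right, inner_smul_right, inner_self_eq_norm_sq_to_K, Complex.sub_im, h1]
      simp [← Complex.ofReal_pow]
    have h3 : |w.im| * ‖(u : H)‖ ^ 2 ≤ ‖(u : H)‖ * ‖A u - w • (u : H)‖ := by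
      calc |w.im| * ‖(u : H)‖ ^ 2 = |(⟪(u : H), A u - w • (u : H)⟫_ℂ).im| := by
            rw [h2, abs_neg, abs_mul, abs_of_nonneg (sq_nonneg ‖(u : H)‖)]
        _ ≤ ‖⟪(u : H), A u - w • (u : H)⟫_ℂ‖ := Complex.abs_im_le_norm _
        _ ≤ _ := norm_inner_le_norm _ _
    nlinarith
  refine hA.mem_resolventSetP_of_bound (abs_pos.2 hz) (key z) fun u hu => ?_
  have := key ((starRingEnd ℂ) z) u
  rw [hu, sub_self, norm_zero] at this
  have h1 : 0 < |((starRingEnd ℂ) z).im| := by simpa using hz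
  exact norm_le_zero_iff.1 (by nlinarith)

lemma IsSelfAdjoint.mem_resolventSetP_of_lower_bound {A : H →ₗ.[ℂ] H} (hA : IsSelfAdjoint A)
    {x δ : ℝ} (hδ : 0 < δ)
    (hb : ∀ u : A.domain, δ * ‖(u : H)‖ ^ 2 ≤ (⟪(u : H), A u - (x : ℂ) • (u : H)⟫_ℂ).re) :
    (x : ℂ) ∈ resolventSetP A := by
  have key : ∀ u : A.domain, δ * ‖(u : H)‖ ≤ ‖A u - (x : ℂ) • (u : H)‖ := by
    intro u
    rcases eq_or_ne ‖(u : H)‖ 0 with h0 | h0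
    · simp [h0]
    have hpos : 0 < ‖(u : H)‖ := lt_of_le_of_ne (norm_nonneg _) (Ne.symm h0)
    have h3 := (hb u).trans ((Complex.re_le_norm _).trans (norm_inner_le_norm _ _))
    nlinarith
  refine hA.mem_resolventSetP_of_bound hδ key fun u hu => ?_
  have := key u
  rw [hu, Complex.conj_ofReal, sub_self, norm_zero] at this
  exact norm_le_zero_iff.1 (by nlinarith)

/-- The spectrum of a self-adjoint operator on a nontrivial space contains a real point. -/
lemma IsSelfAdjoint.exists_real_mem_specP [Nontrivial H] {A : H →ₗ.[ℂ] H}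
    (hA : IsSelfAdjoint A) : ∃ x : ℝ, (x : ℂ) ∈ specP A := by
  by_contra! hcon
  have hall : ∀ z : ℂ, z ∈ resolventSetP A := by
    intro z
    by_cases hz : z.im = 0
    · have := hcon z.re
      rw [specP, Set.mem_compl_iff, not_not] at this
      rwa [show ((z.re : ℝ) : ℂ) = z from Complex.ext (by simp) (by simp [hz])] at this
    · exact hA.mem_resolventSetP_of_im_ne_zero hz
  set T := res A 0 with hT
  have hsa : IsSelfAdjoint T := by
    rw [ContinuousLinearMap.isSelfAdjoint_iff', hT, hA.adjoint_res (hall _) (hall _)]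
    simp
  have hspec : spectrum ℂ T ⊆ {0} := by
    intro μ hμ
    by_contra hne
    have hμ0 : μ ≠ 0 := hne
    apply hμ
    rw [spectrum.mem_resolventSet_iff]
    set Q := res A μ⁻¹ with hQ
    have hTQ : T * Q = Q * T := res_comm (hall _) (hall _)
    have hid : Q = T + μ⁻¹ • (Q * T) := by
      ext x
      have := res_identity (hall μ⁻¹) (hall 0) x
      simpa using this
    have e1 : (algebraMap ℂ (H →L[ℂ] H) μ - T) * (μ⁻¹ • (1 + μ⁻¹ • Q)) = 1 := by
      have : (algebraMap ℂ (H →L[ℂ] H) μ - T) * (μ⁻¹ • (1 + μ⁻¹ • Q))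
          = 1 + μ⁻¹ • (Q - (T + μ⁻¹ • (Q * T))) := by
        rw [Algebra.algebraMap_eq_smul_one, ← hTQ]
        simp only [sub_mul, mul_smul_comm, smul_mul_assoc, one_mul, mul_add, mul_one, smul_add,
          smul_smul, smul_sub]
        simp only [inv_mul_cancel₀ hμ0, one_smul, mul_assoc, mul_one]
        abel
      rw [this, ← hid]; simp
    have e2 : (μ⁻¹ • (1 + μ⁻¹ • Q)) * (algebraMap ℂ (H →L[ℂ] H) μ - T) = 1 := by
      have hc : Commute (algebraMap ℂ (H →L[ℂ] H) μ - T) (μ⁻¹ • (1 + μ⁻¹ • Q)) := by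
        apply Commute.sub_left
        · exact Algebra.commutes _ _
        · refine Commute.smul_right (Commute.add_right (Commute.one_right _) ?_) _
          exact Commute.smul_right hTQ _
      rw [← hc.eq, e1]
    exact ⟨⟨_, _, e1, e2⟩, rfl⟩
  have hrad : spectralRadius ℂ T = 0 := by
    refine le_antisymm (iSup₂_le fun k hk => ?_) bot_le
    rw [hspec hk]; simp
  rw [hsa.spectralRadius_eq_nnnorm] at hrad
  have hT0 : T = 0 := by simpa using hrad
  obtain ⟨x, hx⟩ := exists_ne (0 : H)
  apply hx
  apply res_injective (hall 0)
  rw [← hT, hT0]; simp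

/-! ### Analytic families of square roots of resolvents -/

lemma isOpen_offCut (c : ℝ) : IsOpen (offCut c) :=
  (isOpen_ne_fun Complex.continuous_im continuous_const).union
    (isOpen_lt Complex.continuous_re continuous_const)

lemma isPreconnected_offCut (c : ℝ) : IsPreconnected (offCut c) := by
  have h : offCut c = (fun w : ℂ => (c : ℂ) - w) '' Complex.slitPlane := by
    ext z
    constructor
    · intro hz
      refine ⟨c - z, ?_, by simp⟩
      rw [Complex.mem_slitPlane_iff]
      rcases hz with h | h
      · right; simpa using h
      · left; simpa using h
    · rintro ⟨w, hw, rfl⟩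
      rw [Complex.mem_slitPlane_iff] at hw
      rcases hw with h | h
      · right; simpa using h
      · left; simpa using h
  rw [h]
  have h1 : IsPreconnected Complex.slitPlane :=
    (Complex.starConvex_one_slitPlane.isPathConnected
      Complex.one_mem_slitPlane).isConnected.isPreconnected
  exact h1.image _ (by fun_prop)

lemma ofReal_mem_offCut {c x : ℝ} (h : x < c) : (x : ℂ) ∈ offCut c := Or.inr (by simpa using h)

lemma conj_mem_offCut {c : ℝ} {z : ℂ} (h : z ∈ offCut c) : (starRingEnd ℂ) z ∈ offCut c := by
  rcases h with h | h
  · left; simpa using h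
  · right; simpa using h

lemma offCut_mono {c d : ℝ} (h : c ≤ d) : offCut c ⊆ offCut d := by
  rintro z (hz | hz)
  · exact Or.inl hz
  · exact Or.inr (hz.trans_le h)

/-- Identity theorem on a cut plane for functions agreeing on the real half-line. -/
lemma eqOn_offCut {E : Type*} [NormedAddCommGroup E] [NormedSpace ℂ E] [CompleteSpace E] {c : ℝ}
    {f g : ℂ → E} (hf : DifferentiableOn ℂ f (offCut c)) (hg : DifferentiableOn ℂ g (offCut c))
    (h : ∀ x : ℝ, x < c → f x = g x) : Set.EqOn f g (offCut c) := by
  have hx : ((c - 1 : ℝ) : ℂ) ∈ offCut c := ofReal_mem_offCut (by linarith)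
  refine (hf.analyticOnNhd (isOpen_offCut c)).eqOn_of_preconnected_of_frequently_eq
    (hg.analyticOnNhd (isOpen_offCut c)) (isPreconnected_offCut c) hx ?_
  have ht : Tendsto (fun y : ℝ => (y : ℂ)) (nhdsWithin (c - 1) {c - 1}ᶜ)
      (nhdsWithin ((c - 1 : ℝ) : ℂ) {((c - 1 : ℝ) : ℂ)}ᶜ) := by
    refine tendsto_nhdsWithin_iff.2 ⟨?_, ?_⟩
    · exact (Complex.continuous_ofReal.tendsto (c - 1)).mono_left nhdsWithin_le_nhds
    · filter_upwards [self_mem_nhdsWithin] with y hy hy'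
      exact hy (Complex.ofReal_injective hy')
  refine ht.frequently (Eventually.frequently ?_)
  filter_upwards [nhdsWithin_le_nhds (Iio_mem_nhds (show c - 1 < c by linarith))] with y hy
  exact h y hy

/-- `N` is the analytic family `z ↦ (A - z)^{-1/2}` on the plane cut along `[c, ∞)`. -/
structure IsInvSqrtFamily (A : H →ₗ.[ℂ] H) (c : ℝ) (N : ℂ → (H →L[ℂ] H)) : Prop where
  mem_res : offCut c ⊆ resolventSetP A
  sq : ∀ z ∈ offCut c, N z * N z = res A z
  nonneg : ∀ x : ℝ, x < c → 0 ≤ N x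
  diff : DifferentiableOn ℂ N (offCut c)

namespace IsInvSqrtFamily

variable {A : H →ₗ.[ℂ] H} {c : ℝ} {N : ℂ → (H →L[ℂ] H)}

lemma adjoint_apply (hN : IsInvSqrtFamily A c N) {z : ℂ} (hz : z ∈ offCut c) :
    ContinuousLinearMap.adjoint (N z) = N ((starRingEnd ℂ) z) := by
  have h : Set.EqOn (fun z => star (N (star z))) N (offCut c) := by
    refine eqOn_offCut ?_ hN.diff fun x hx => ?_
    · intro z hz
      have hz' : star z ∈ offCut c := conj_mem_offCut hz
      have hd : DifferentiableAt ℂ N (star z) :=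
        (hN.diff _ hz').differentiableAt ((isOpen_offCut c).mem_nhds hz')
      have := hd.star_star
      rw [star_star] at this
      exact this.differentiableWithinAt
    · simp only [Complex.star_def, Complex.conj_ofReal]
      exact (hN.nonneg x hx).isSelfAdjoint
  have := h (conj_mem_offCut hz)
  simpa [ContinuousLinearMap.star_eq_adjoint] using this

lemma commute (hN : IsInvSqrtFamily A c N) {z w : ℂ} (hz : z ∈ offCut c) (hw : w ∈ offCut c) :
    N z * N w = N w * N z := by
  have hreal : ∀ x y : ℝ, x < c → y < c → N x * N y = N y * N x := by
    have hs : ∀ x : ℝ, x < c → N x = CFC.sqrt (res A x) := fun x hx =>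
      (CFC.sqrt_unique (hN.sq _ (ofReal_mem_offCut hx)) (hN.nonneg x hx)).symm
    intro x y hx hy
    rw [hs x hx, hs y hy]
    have hc : Commute (res A x) (res A y) :=
      res_comm (hN.mem_res (ofReal_mem_offCut hx)) (hN.mem_res (ofReal_mem_offCut hy))
    have h1 : Commute (CFC.sqrt (res A x)) (res A y) := hc.cfcₙ_nnreal _
    have h2 : Commute (CFC.sqrt (res A y)) (CFC.sqrt (res A x)) := h1.symm.cfcₙ_nnreal _
    exact h2.symm.eq
  have h1 : ∀ x : ℝ, x < c → ∀ z ∈ offCut c, N z * N x = N x * N z := by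
    intro x hx
    exact eqOn_offCut (f := fun z => N z * N x) (g := fun z => N x * N z)
      (hN.diff.mul_const _) (hN.diff.const_mul _) fun y hy => hreal y x hy hx
  exact eqOn_offCut (f := fun w => N z * N w) (g := fun w => N w * N z)
      (hN.diff.const_mul _) (hN.diff.mul_const _) (fun y hy => h1 y hy z hz) hw

lemma injective (hN : IsInvSqrtFamily A c N) {z : ℂ} (hz : z ∈ offCut c) :
    Function.Injective (N z) := by
  have h := res_injective (hN.mem_res hz)
  rw [← hN.sq z hz] at h
  exact Function.Injective.of_comp (f := N z) h

lemma denseRange (hN : IsInvSqrtFamily A c N) {z : ℂ} (hz : z ∈ offCut c) :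
    DenseRange (N z) := by
  have h : (LinearMap.range (N z).toLinearMap).topologicalClosure = ⊤ := by
    rw [Submodule.topologicalClosure_eq_top_iff, Submodule.eq_bot_iff]
    intro y hy
    rw [Submodule.mem_orthogonal] at hy
    apply hN.injective (conj_mem_offCut hz)
    rw [map_zero, ← hN.adjoint_apply hz]
    refine ext_inner_left ℂ fun v => ?_
    rw [ContinuousLinearMap.adjoint_inner_right, inner_zero_right]
    exact hy _ ⟨v, rfl⟩
  rw [← Submodule.dense_iff_topologicalClosure_eq_top] at h
  exact h

end IsInvSqrtFamily

lemma inner_apply_le_of_norm_apply_le {a b : H →L[ℂ] H} (ha : 0 ≤ a) (hb : 0 ≤ b) {C : ℝ}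
    (hC : 0 ≤ C) (h : ∀ x, ‖a x‖ ≤ C * ‖b x‖) (x : H) :
    (⟪x, a x⟫_ℂ).re ≤ C * (⟪x, b x⟫_ℂ).re := by
  have hCb : 0 ≤ C • b := smul_nonneg hC hb
  have hsym : ∀ {t : H →L[ℂ] H}, 0 ≤ t → ∀ x, ⟪x, (t * t) x⟫_ℂ = ((‖t x‖ ^ 2 : ℝ) : ℂ) := by
    intro t ht x
    have hs : ContinuousLinearMap.adjoint t = t :=
      ContinuousLinearMap.isSelfAdjoint_iff'.1 ht.isSelfAdjoint
    change ⟪x, t (t x)⟫_ℂ = _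
    conv_lhs => rw [← hs]
    rw [ContinuousLinearMap.adjoint_inner_right, hs, inner_self_eq_norm_sq_to_K]
    simp
  have hle : a * a ≤ (C • b) * (C • b) := by
    rw [ContinuousLinearMap.le_def, ContinuousLinearMap.isPositive_def]
    have hsa : IsSelfAdjoint ((C • b) * (C • b) - a * a) := by
      have h1 := hCb.isSelfAdjoint
      have h2 := ha.isSelfAdjoint
      refine IsSelfAdjoint.sub ?_ ?_
      · exact (h1.commute_iff h1).1 (Commute.refl _)
      · exact (h2.commute_iff h2).1 (Commute.refl _)
    refine ⟨ContinuousLinearMap.isSelfAdjoint_iff_isSymmetric.1 hsa, fun x => ?_⟩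
    rw [ContinuousLinearMap.reApplyInnerSelf_apply, ← inner_conj_symm, sub_apply,
      inner_sub_right, hsym hCb, hsym ha]
    have h1 : ‖a x‖ ≤ ‖(C • b) x‖ := by
      rw [smul_apply, norm_smul, Real.norm_of_nonneg hC]; exact h x
    have h2 : ‖a x‖ ^ 2 ≤ ‖(C • b) x‖ ^ 2 := by gcongr
    rw [← Complex.ofReal_sub]
    change 0 ≤ (_ : ℂ).re
    rw [Complex.conj_ofReal, Complex.ofReal_re]
    linarith
  have h2 := CFC.sqrt_le_sqrt _ _ hle
  rw [CFC.sqrt_mul_self a ha, CFC.sqrt_mul_self _ hCb, ContinuousLinearMap.le_def] at h2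
  have h3 := h2.re_inner_nonneg_right x
  rw [sub_apply, inner_sub_right, smul_apply,
    inner_smul_right_eq_smul] at h3
  simpa using h3

lemma exists_norm_res_le {A : H →ₗ.[ℂ] H} {z w : ℂ} (hz : z ∈ resolventSetP A)
    (hw : w ∈ resolventSetP A) : ∃ C : ℝ, 0 ≤ C ∧ ∀ x, ‖res A z x‖ ≤ C * ‖res A w x‖ := by
  refine ⟨1 + ‖z - w‖ * ‖res A z‖, by positivity, fun x => ?_⟩
  rw [res_identity hz hw x]
  refine (norm_add_le _ _).trans ?_
  rw [norm_smul]
  have := (res A z).le_opNorm (res A w x)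
  have h2 : ‖z - w‖ * ‖res A z (res A w x)‖ ≤ ‖z - w‖ * (‖res A z‖ * ‖res A w x‖) := by gcongr
  linarith

namespace IsInvSqrtFamily

variable {A : H →ₗ.[ℂ] H} {c : ℝ} {N : ℂ → (H →L[ℂ] H)}

/-- `‖(A - z)^{-1/2} x‖²` is comparable to `⟨x, (A - t)⁻¹ x⟩` for real `t` below the cut. -/
lemma exists_norm_sq_comparison (hN : IsInvSqrtFamily A c N) {z : ℂ} (hz : z ∈ offCut c) {t : ℝ}
    (ht : t < c) :
    ∃ C : ℝ, 0 ≤ C ∧ ∀ x, ‖N z x‖ ^ 2 ≤ C * (⟪x, res A t x⟫_ℂ).re ∧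
      (⟪x, res A t x⟫_ℂ).re ≤ C * ‖N z x‖ ^ 2 := by
  have hz' := conj_mem_offCut hz
  have htm := ofReal_mem_offCut ht
  set P : H →L[ℂ] H := star (N z) * N z with hP
  have hP0 : 0 ≤ P := star_mul_self_nonneg _
  have hadj : star (N z) = N ((starRingEnd ℂ) z) := hN.adjoint_apply hz
  have hR0 : 0 ≤ res A t := by
    have h := hN.nonneg t ht
    rw [← hN.sq _ htm]
    nth_rw 1 [← h.isSelfAdjoint.star_eq]
    exact star_mul_self_nonneg _
  have hPx : ∀ x, ⟪x, P x⟫_ℂ = ((‖N z x‖ ^ 2 : ℝ) : ℂ) := by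
    intro x
    change ⟪x, ContinuousLinearMap.adjoint (N z) (N z x)⟫_ℂ = _
    rw [ContinuousLinearMap.adjoint_inner_right, inner_self_eq_norm_sq_to_K]
    simp
  have hPn : ∀ x, ‖P x‖ = ‖res A z x‖ := by
    intro x
    have h1 : star P * P = star (res A z) * res A z := by
      have hc := hN.commute hz hz'
      rw [← hN.sq z hz, star_mul, hP, star_mul, star_star, hadj]
      simp only [mul_assoc]
      congr 1
      rw [← mul_assoc, hc, mul_assoc]
    have hn : ∀ t : H →L[ℂ] H, ((‖t x‖ ^ 2 : ℝ) : ℂ) = ⟪x, (star t * t) x⟫_ℂ := by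
      intro t
      change _ = ⟪x, ContinuousLinearMap.adjoint t (t x)⟫_ℂ
      rw [ContinuousLinearMap.adjoint_inner_right, inner_self_eq_norm_sq_to_K]
      simp
    have h2 : ((‖P x‖ ^ 2 : ℝ) : ℂ) = ((‖res A z x‖ ^ 2 : ℝ) : ℂ) := by rw [hn, hn, h1]
    have h3 := Complex.ofReal_injective h2
    exact (sq_eq_sq₀ (norm_nonneg _) (norm_nonneg _)).1 h3
  obtain ⟨C1, hC1, h1⟩ := exists_norm_res_le (hN.mem_res hz) (hN.mem_res htm)
  obtain ⟨C2, hC2, h2⟩ := exists_norm_res_le (hN.mem_res htm) (hN.mem_res hz)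
  refine ⟨max C1 C2, le_max_of_le_left hC1, fun x => ?_⟩
  have e1 := inner_apply_le_of_norm_apply_le hP0 hR0 hC1 (fun x => by rw [hPn]; exact h1 x) x
  have e2 := inner_apply_le_of_norm_apply_le hR0 hP0 hC2 (fun x => by rw [hPn]; exact h2 x) x
  rw [hPx, Complex.ofReal_re] at e1 e2
  have hp := ((ContinuousLinearMap.nonneg_iff_isPositive _).1 hR0).re_inner_nonneg_right x
  constructor
  · exact e1.trans (mul_le_mul_of_nonneg_right (le_max_left _ _) hp)
  · exact e2.trans (mul_le_mul_of_nonneg_right (le_max_right _ _) (sq_nonneg _))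

end IsInvSqrtFamily

/-- Douglas' factorization lemma, for an injective majorant. -/
lemma exists_comp_eq_of_norm_adjoint_le {S T : H →L[ℂ] H} (hS : Function.Injective S) {C : ℝ}
    (h : ∀ x, ‖ContinuousLinearMap.adjoint T x‖ ≤ C * ‖ContinuousLinearMap.adjoint S x‖) :
    ∃ Q : H →L[ℂ] H, S.comp Q = T := by
  have hd : DenseRange (ContinuousLinearMap.adjoint S) := by
    have h : (LinearMap.range (ContinuousLinearMap.adjoint S).toLinearMap).topologicalClosure
        = ⊤ := by
      rw [Submodule.topologicalClosure_eq_top_iff, Submodule.eq_bot_iff]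
      intro y hy
      rw [Submodule.mem_orthogonal] at hy
      apply hS
      rw [map_zero]
      refine ext_inner_left ℂ fun v => ?_
      rw [← ContinuousLinearMap.adjoint_inner_left, inner_zero_right]
      exact hy _ ⟨v, rfl⟩
    rw [← Submodule.dense_iff_topologicalClosure_eq_top] at h
    exact h
  let E : H →L[ℂ] H := (ContinuousLinearMap.adjoint T).toLinearMap.extendOfNorm
    (ContinuousLinearMap.adjoint S).toLinearMap
  have hE : ∀ x, E (ContinuousLinearMap.adjoint S x) = ContinuousLinearMap.adjoint T x :=
    fun x => LinearMap.extendOfNorm_eq (f := (ContinuousLinearMap.adjoint T).toLinearMap)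
      (e := (ContinuousLinearMap.adjoint S).toLinearMap) hd ⟨C, h⟩ x
  refine ⟨ContinuousLinearMap.adjoint E, ?_⟩
  have hE' : E.comp (ContinuousLinearMap.adjoint S) = ContinuousLinearMap.adjoint T :=
    ContinuousLinearMap.ext hE
  have := congrArg ContinuousLinearMap.adjoint hE'
  rwa [ContinuousLinearMap.adjoint_comp, ContinuousLinearMap.adjoint_adjoint,
    ContinuousLinearMap.adjoint_adjoint] at this

/-! ### Operators of rank at most two -/

lemma isTraceClass_of_rank_two {G : H →L[ℂ] H} {y1 y2 : H} {p1 p2 : H →L[ℂ] ℂ}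
    (hG : ∀ x, G x = p1 x • y1 + p2 x • y2) : IsTraceClass G := by
  have key : ∀ (p : H →L[ℂ] ℂ) (y : H), ∃ C : ℝ, ∀ (n : ℕ) (e f : Fin n → H),
      Orthonormal ℂ e → Orthonormal ℂ f → ∑ i, ‖p (f i)‖ * ‖⟪e i, y⟫_ℂ‖ ≤ C := by
    intro p y
    set q := (InnerProductSpace.toDual ℂ H).symm p with hq
    refine ⟨(‖q‖ ^ 2 + ‖y‖ ^ 2) / 2, fun n e f he hf => ?_⟩
    have hp : ∀ x, ‖p x‖ = ‖⟪x, q⟫_ℂ‖ := by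
      intro x
      rw [norm_inner_symm, hq, InnerProductSpace.toDual_symm_apply]
    have h1 := hf.sum_inner_products_le q (s := Finset.univ)
    have h2 := he.sum_inner_products_le y (s := Finset.univ)
    calc ∑ i, ‖p (f i)‖ * ‖⟪e i, y⟫_ℂ‖
        ≤ ∑ i, (‖⟪f i, q⟫_ℂ‖ ^ 2 + ‖⟪e i, y⟫_ℂ‖ ^ 2) / 2 := by
          refine Finset.sum_le_sum fun i _ => ?_
          rw [hp]
          nlinarith [sq_nonneg (‖⟪f i, q⟫_ℂ‖ - ‖⟪e i, y⟫_ℂ‖)]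
      _ = (∑ i, ‖⟪f i, q⟫_ℂ‖ ^ 2 + ∑ i, ‖⟪e i, y⟫_ℂ‖ ^ 2) / 2 := by
          rw [← Finset.sum_div, Finset.sum_add_distrib]
      _ ≤ _ := by linarith
  obtain ⟨C1, h1⟩ := key p1 y1
  obtain ⟨C2, h2⟩ := key p2 y2
  refine ⟨C1 + C2, fun n e f he hf => ?_⟩
  refine le_trans ?_ (add_le_add (h1 n e f he hf) (h2 n e f he hf))
  rw [← Finset.sum_add_distrib]
  refine Finset.sum_le_sum fun i _ => ?_
  rw [hG, inner_add_right, inner_smul_right, inner_smul_right]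
  refine (norm_add_le _ _).trans ?_
  rw [norm_mul, norm_mul]

/-- An operator sandwiched between an injective operator and one of dense range has rank at most
two as soon as the product does, i.e. any three values of the product are dependent. -/
lemma exists_rank_two_of_sandwich {S T F G : H →L[ℂ] H} (hS : Function.Injective S)
    (hT : DenseRange T) (hF : S.comp (G.comp T) = F)
    (h3 : ∀ x : Fin 3 → H, ¬ LinearIndependent ℂ fun i => F (x i)) :
    ∃ (y1 y2 : H) (p1 p2 : H →L[ℂ] ℂ), ∀ x, G x = p1 x • y1 + p2 x • y2 := by
  set W := LinearMap.range F.toLinearMap with hW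
  have hrank : Module.rank ℂ W ≤ (2 : ℕ) := by
    refine rank_le fun s hs => ?_
    by_contra! hcard
    obtain ⟨e⟩ : Nonempty (Fin 3 ↪ s) := by
      rw [Function.Embedding.nonempty_iff_card_le]; simpa using Nat.succ_le_of_lt hcard
    have h1 : LinearIndependent ℂ (fun i : Fin 3 => ((e i : W) : H)) := by
      have := (hs.comp e e.injective).map' W.subtype (by simp)
      exact this
    choose x hx using fun i : Fin 3 => (e i : W).2
    apply h3 x
    convert h1 using 2 with i
    exact hx i
  have hfin : FiniteDimensional ℂ W :=
    Module.rank_lt_aleph0_iff.1 (hrank.trans_lt (Cardinal.natCast_lt_aleph0))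
  set Y := W.comap S.toLinearMap with hY
  let j : Y →ₗ[ℂ] W := S.toLinearMap.restrict (p := Y) (q := W) fun x hx => hx
  have hj : Function.Injective j := by
    intro a b hab
    apply Subtype.ext
    apply hS
    exact congrArg Subtype.val hab
  have hYfin : FiniteDimensional ℂ Y := FiniteDimensional.of_injective j hj
  have hYrank : Module.finrank ℂ Y ≤ 2 :=
    (LinearMap.finrank_le_finrank_of_injective hj).trans
      (Module.finrank_le_of_rank_le hrank)
  have hGY : ∀ x, G x ∈ Y := by
    intro x
    refine hT.induction_on (p := fun x => G x ∈ Y) x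
      (Y.closed_of_finiteDimensional.preimage G.continuous) fun a => ?_
    refine ⟨a, ?_⟩
    rw [← hF]; rfl
  let G' : H →L[ℂ] Y := G.codRestrict Y hGY
  have hG' : ∀ x, ((G' x : Y) : H) = G x := fun x => rfl
  obtain ⟨m, hm, b⟩ : ∃ m : ℕ, m ≤ 2 ∧ Nonempty (Module.Basis (Fin m) ℂ Y) :=
    ⟨_, hYrank, ⟨Module.finBasis ℂ Y⟩⟩
  obtain ⟨b⟩ := b
  let p : Fin m → H →L[ℂ] ℂ := fun i => (LinearMap.toContinuousLinearMap (b.coord i)).comp G'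
  have hsum : ∀ x, G x = ∑ i, p i x • (b i : H) := by
    intro x
    have := congrArg Subtype.val (b.sum_repr (G' x))
    rw [hG'] at this
    rw [← this, Submodule.coe_sum]
    rfl
  interval_cases m
  · exact ⟨0, 0, 0, 0, fun x => by rw [hsum]; simp⟩
  · exact ⟨b 0, 0, p 0, 0, fun x => by rw [hsum]; simp⟩
  · exact ⟨b 0, b 1, p 0, p 1, fun x => by rw [hsum]; simp⟩

/-! ### Absolutely continuous functions and a Sobolev-type inequality -/

lemma absolutelyContinuousOnInterval_integral {k : ℝ → ℂ} {a b : ℝ}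
    (hk : IntervalIntegrable k volume a b) (C : ℂ) :
    AbsolutelyContinuousOnInterval (fun x => C + ∫ t in a..x, k t) a b := by
  have hconst : ∀ w : ℂ, AbsolutelyContinuousOnInterval (fun _ : ℝ => w) a b := fun w =>
    ((LipschitzWith.const w).lipschitzOnWith (s := Set.uIcc a b)).absolutelyContinuousOnInterval
  have hre : IntervalIntegrable (fun t => (k t).re) volume a b := ⟨hk.1.re, hk.2.re⟩
  have him : IntervalIntegrable (fun t => (k t).im) volume a b := ⟨hk.1.im, hk.2.im⟩
  have h1 := (hre.absolutelyContinuousOnInterval_intervalIntegral (c := a) (by simp)).smul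
    (hconst 1)
  have h2 := (him.absolutelyContinuousOnInterval_intervalIntegral (c := a) (by simp)).smul
    (hconst Complex.I)
  have h3 := ((hconst C).add (h1.add h2)).mono (c := a) (d := b) le_rfl
  rw [absolutelyContinuousOnInterval_iff] at h3 ⊢
  have heq : ∀ x ∈ Set.uIcc a b, (C + ∫ t in a..x, k t) =
      ((fun _ : ℝ => C) + ((fun x => ∫ t in a..x, (k t).re) • (fun _ : ℝ => (1 : ℂ)) +
        (fun x => ∫ t in a..x, (k t).im) • (fun _ : ℝ => Complex.I))) x := by
    intro x hx
    have hkx : IntervalIntegrable k volume a x :=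
      hk.mono_set (Set.uIcc_subset_uIcc Set.left_mem_uIcc hx)
    have e : ∫ t in a..x, k t = ((∫ t in a..x, (k t).re : ℝ) : ℂ)
        + ((∫ t in a..x, (k t).im : ℝ) : ℂ) * Complex.I := by
      apply Complex.ext
      · simpa using (intervalIntegral.intervalIntegral_re (𝕜 := ℂ) hkx).symm
      · simpa using (intervalIntegral.intervalIntegral_im (𝕜 := ℂ) hkx).symm
    simp [e]
  intro ε hε
  obtain ⟨δ, hδ, h⟩ := h3 ε hε
  refine ⟨δ, hδ, fun E hE hlen => ?_⟩
  have := h E hE hlen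
  refine lt_of_eq_of_lt ?_ this
  refine Finset.sum_congr rfl fun i hi => ?_
  rw [heq _ (hE.1 i hi).1, heq _ (hE.1 i hi).2]

/-- Integration by parts for indefinite integrals. -/
lemma integral_mul_add_mul_of_primitives {a b : ℝ} (hab : a ≤ b) {k l U W : ℝ → ℂ}
    (hk : IntervalIntegrable k volume a b) (hl : IntervalIntegrable l volume a b)
    (hU : ∀ x ∈ Set.Icc a b, U x = U a + ∫ t in a..x, k t)
    (hW : ∀ x ∈ Set.Icc a b, W x = W a + ∫ t in a..x, l t) :
    ∫ t in a..b, (k t * W t + U t * l t) = U b * W b - U a * W a := by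
  set U' : ℝ → ℂ := fun x => U a + ∫ t in a..x, k t with hU'
  set W' : ℝ → ℂ := fun x => W a + ∫ t in a..x, l t with hW'
  have hUac : AbsolutelyContinuousOnInterval U' a b := absolutelyContinuousOnInterval_integral hk _
  have hWac : AbsolutelyContinuousOnInterval W' a b := absolutelyContinuousOnInterval_integral hl _
  set m : ℝ → ℂ := fun t => k t * W' t + U' t * l t with hm
  have hmi : IntervalIntegrable m volume a b :=
    (hk.mul_continuousOn hWac.continuousOn).add (hl.continuousOn_mul hUac.continuousOn)
  have hPac : AbsolutelyContinuousOnInterval (fun x => 0 + ∫ t in a..x, m t) a b :=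
    absolutelyContinuousOnInterval_integral hmi _
  have hUW : AbsolutelyContinuousOnInterval (U' • W') a b := hUac.smul hWac
  have hΦ := hUW.sub hPac
  obtain ⟨C, hC⟩ := hΦ.const_of_ae_hasDerivAt_zero (by
    filter_upwards [hk.ae_hasDerivAt_integral, hl.ae_hasDerivAt_integral,
      hmi.ae_hasDerivAt_integral] with x h1 h2 h3 hx
    have d1 : HasDerivAt U' (k x) x := (h1 hx a (by simp)).const_add _
    have d2 : HasDerivAt W' (l x) x := (h2 hx a (by simp)).const_add _
    have d3 : HasDerivAt (fun x => 0 + ∫ t in a..x, m t) (m x) x :=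
      (h3 hx a (by simp)).const_add _
    have d4 := (d1.mul d2).sub d3
    rw [hm, sub_self] at d4
    exact d4)
  have ha := hC a (by simp)
  have hb := hC b (by simp)
  have hfin : ∫ t in a..b, m t = U' b * W' b - U' a * W' a := by
    change U' a * W' a - (0 + ∫ t in a..a, m t) = C at ha
    change U' b * W' b - (0 + ∫ t in a..b, m t) = C at hb
    rw [intervalIntegral.integral_same] at ha
    linear_combination ha - hb
  have hUe : ∀ x ∈ Set.Icc a b, U x = U' x := hU
  have hWe : ∀ x ∈ Set.Icc a b, W x = W' x := hW
  rw [hUe b (by simp [hab]), hWe b (by simp [hab]), hUe a (by simp [hab]), hWe a (by simp [hab]),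
    ← hfin]
  apply intervalIntegral.integral_congr
  intro x hx
  rw [Set.uIcc_of_le hab] at hx
  simp only [hm]
  rw [hUe x hx, hWe x hx]

/-- `u` is continuously differentiable on `[0,R]` with derivative `du`. -/
structure IsC1Pair (R : ℝ) (u du : ℝ → ℂ) : Prop where
  hasDeriv : ∀ x ∈ Set.Icc (0 : ℝ) R, HasDerivWithinAt u (du x) (Set.Icc (0 : ℝ) R) x
  cont : ContinuousOn du (Set.Icc (0 : ℝ) R)

namespace IsC1Pair

variable {R : ℝ} {u du v dv : ℝ → ℂ}

lemma continuousOn (h : IsC1Pair R u du) : ContinuousOn u (Set.Icc 0 R) :=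
  fun x hx => (h.hasDeriv x hx).continuousWithinAt

lemma sub_const_mul (h : IsC1Pair R u du) (h' : IsC1Pair R v dv) (c : ℂ) :
    IsC1Pair R (fun x => u x - c * v x) (fun x => du x - c * dv x) :=
  ⟨fun x hx => (h.hasDeriv x hx).sub ((h'.hasDeriv x hx).const_mul c),
    h.cont.sub (continuousOn_const.mul h'.cont)⟩

lemma conj (h : IsC1Pair R u du) :
    IsC1Pair R (fun x => (starRingEnd ℂ) (u x)) (fun x => (starRingEnd ℂ) (du x)) :=
  ⟨fun x hx => (h.hasDeriv x hx).star, Complex.continuous_conj.comp_continuousOn h.cont⟩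

lemma eq_add_integral (h : IsC1Pair R u du) {x : ℝ} (hx : x ∈ Set.Icc 0 R) :
    u x = u 0 + ∫ t in (0 : ℝ)..x, du t := by
  have hsub : Set.Icc 0 x ⊆ Set.Icc 0 R := Set.Icc_subset_Icc_right hx.2
  rw [intervalIntegral.integral_eq_sub_of_hasDeriv_right_of_le hx.1 (h.continuousOn.mono hsub)
    (f' := du)]
  · ring
  · intro y hy
    have hy' : y ∈ Set.Ioo 0 R := ⟨hy.1, hy.2.trans_le hx.2⟩
    exact ((h.hasDeriv y (Set.Ioo_subset_Icc_self hy')).hasDerivAt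
      (Icc_mem_nhds hy'.1 hy'.2)).hasDerivWithinAt
  · exact (h.cont.mono (by rwa [Set.uIcc_of_le hx.1])).intervalIntegrable

lemma norm_sq_le (hR : 0 < R) (h : IsC1Pair R u du) {ε : ℝ} (hε : 0 < ε) {x : ℝ}
    (hx : x ∈ Set.Icc 0 R) :
    ‖u x‖ ^ 2 ≤ ε * (∫ t in (0 : ℝ)..R, ‖du t‖ ^ 2)
      + (1 / R + 1 / ε) * ∫ t in (0 : ℝ)..R, ‖u t‖ ^ 2 := by
  set E := ∫ t in (0 : ℝ)..R, ‖du t‖ ^ 2 with hE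
  set N := ∫ t in (0 : ℝ)..R, ‖u t‖ ^ 2 with hN
  have hucc : Set.uIcc 0 R = Set.Icc 0 R := Set.uIcc_of_le hR.le
  have huI : IntervalIntegrable (fun t => ‖u t‖ ^ 2) volume 0 R :=
    ContinuousOn.intervalIntegrable (by rw [hucc]; exact h.continuousOn.norm.pow 2)
  have hduI : IntervalIntegrable (fun t => ‖du t‖ ^ 2) volume 0 R :=
    ContinuousOn.intervalIntegrable (by rw [hucc]; exact h.cont.norm.pow 2)
  set φ : ℝ → ℝ := fun t => ε * ‖du t‖ ^ 2 + 1 / ε * ‖u t‖ ^ 2 with hφ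
  have hφI : IntervalIntegrable φ volume 0 R := (hduI.const_mul ε).add (huI.const_mul (1 / ε))
  have hφint : ∫ t in (0 : ℝ)..R, φ t = ε * E + 1 / ε * N := by
    rw [hφ, intervalIntegral.integral_add (hduI.const_mul ε) (huI.const_mul (1 / ε)),
      intervalIntegral.integral_const_mul, intervalIntegral.integral_const_mul]
  have hdiff : ∀ y ∈ Set.Icc 0 R, ‖u x‖ ^ 2 ≤ ‖u y‖ ^ 2 + (ε * E + 1 / ε * N) := by
    intro y hy
    set ψ : ℝ → ℝ := fun t => 2 * inner ℝ (u t) (du t) with hψ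
    have hsub : Set.uIcc y x ⊆ Set.Icc 0 R := by
      rw [← hucc]; exact Set.uIcc_subset_uIcc (by rwa [hucc]) (by rwa [hucc])
    have hψc : ContinuousOn ψ (Set.Icc 0 R) :=
      continuousOn_const.mul (h.continuousOn.inner h.cont)
    have hψI : IntervalIntegrable ψ volume 0 R :=
      ContinuousOn.intervalIntegrable (by rwa [hucc])
    have hftc : ∫ t in y..x, ψ t = ‖u x‖ ^ 2 - ‖u y‖ ^ 2 := by
      apply intervalIntegral.integral_eq_sub_of_hasDeriv_right
      · exact (h.continuousOn.norm.pow 2).mono hsub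
      · intro s hs
        have hs' : s ∈ Set.Ioo 0 R := by
          have h1 := hs.1
          have h2 := hs.2
          exact ⟨lt_of_le_of_lt (le_min hy.1 hx.1) h1, lt_of_lt_of_le h2 (max_le hy.2 hx.2)⟩
        have hd := (h.hasDeriv s (Set.Ioo_subset_Icc_self hs')).hasDerivAt
          (Icc_mem_nhds hs'.1 hs'.2)
        exact hd.norm_sq.hasDerivWithinAt
      · exact (hψc.mono hsub).intervalIntegrable
    have hψφ : ∀ t, ‖ψ t‖ ≤ φ t := by
      intro t
      rw [hψ, Real.norm_eq_abs, abs_mul, abs_two]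
      have h1 := abs_real_inner_le_norm (u t) (du t)
      have h2 : 0 ≤ (ε * ‖du t‖ - ‖u t‖) ^ 2 / ε := by positivity
      have h3 : (ε * ‖du t‖ - ‖u t‖) ^ 2 / ε = φ t - 2 * (‖u t‖ * ‖du t‖) := by
        rw [hφ]; field_simp; ring
      linarith
    have hle : ∫ t in y..x, ψ t ≤ ∫ t in (0 : ℝ)..R, φ t := by
      refine (le_abs_self _).trans ?_
      rw [← Real.norm_eq_abs]
      refine intervalIntegral.norm_integral_le_integral_norm_uIoc.trans ?_
      rw [intervalIntegral.integral_of_le hR.le]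
      have hs2 : Set.uIoc y x ⊆ Set.Ioc 0 R :=
         Set.Ioc_subset_Ioc (le_min hy.1 hx.1) (max_le hy.2 hx.2)
      have hI1 : IntegrableOn ψ (Set.Ioc 0 R) := (intervalIntegrable_iff_integrableOn_Ioc_of_le hR.le).1 hψI
      have hI2 : IntegrableOn φ (Set.Ioc 0 R) := (intervalIntegrable_iff_integrableOn_Ioc_of_le hR.le).1 hφI
      calc ∫ t in Set.uIoc y x, ‖ψ t‖ ≤ ∫ t in Set.Ioc 0 R, ‖ψ t‖ :=
            setIntegral_mono_set hI1.norm (Eventually.of_forall fun _ => norm_nonneg _)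
              hs2.eventuallyLE
        _ ≤ ∫ t in Set.Ioc 0 R, φ t := integral_mono hI1.norm hI2 hψφ
    rw [hftc, hφint] at hle
    linarith
  have hmono : ∫ _ in (0 : ℝ)..R, ‖u x‖ ^ 2 ≤ ∫ y in (0 : ℝ)..R, (‖u y‖ ^ 2 + (ε * E + 1 / ε * N)) :=
    intervalIntegral.integral_mono_on hR.le intervalIntegrable_const
      (huI.add intervalIntegrable_const) hdiff
  rw [intervalIntegral.integral_add huI intervalIntegrable_const,
    intervalIntegral.integral_const, intervalIntegral.integral_const, ← hN] at hmono
  simp only [sub_zero, smul_eq_mul] at hmono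
  have : ‖u x‖ ^ 2 ≤ (N + R * (ε * E + 1 / ε * N)) / R := by
    rw [le_div_iff₀ hR]; linarith
  refine this.trans (le_of_eq ?_)
  field_simp
  ring

end IsC1Pair

/-! ### The quadratic form of a Schrödinger operator -/

section Schrodinger

variable {R : ℝ} {V : ℝ → ℝ}

lemma intervalIntegrable_of_ae_eq_Lp (hR : 0 < R) {h : SchSp R} {h0 : ℝ → ℂ}
    (hh : ∀ᵐ x ∂(volume.restrict (Set.Ioo (0 : ℝ) R)), h x = h0 x) :
    IntervalIntegrable h0 volume 0 R := by
  rw [intervalIntegrable_iff_integrableOn_Ioo_of_le hR.le]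
  exact (((Lp.memLp h).integrable (by norm_num)).congr hh)

lemma inner_eq_intervalIntegral (hR : 0 < R) {f h : SchSp R} {u h0 : ℝ → ℂ}
    (hf : ∀ᵐ x ∂(volume.restrict (Set.Ioo (0 : ℝ) R)), f x = u x)
    (hh : ∀ᵐ x ∂(volume.restrict (Set.Ioo (0 : ℝ) R)), h x = h0 x) :
    ⟪f, h⟫_ℂ = ∫ t in (0 : ℝ)..R, (starRingEnd ℂ) (u t) * h0 t := by
  rw [L2.inner_def, intervalIntegral.integral_of_le hR.le, integral_Ioc_eq_integral_Ioo]
  refine integral_congr_ae ?_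
  filter_upwards [hf, hh] with x h1 h2
  rw [h1, h2, RCLike.inner_apply, mul_comm]

lemma norm_sq_eq_intervalIntegral (hR : 0 < R) {f : SchSp R} {u : ℝ → ℂ}
    (hf : ∀ᵐ x ∂(volume.restrict (Set.Ioo (0 : ℝ) R)), f x = u x) :
    ‖f‖ ^ 2 = ∫ t in (0 : ℝ)..R, ‖u t‖ ^ 2 := by
  have h1 : ⟪f, f⟫_ℂ = ((‖f‖ ^ 2 : ℝ) : ℂ) := by
    rw [inner_self_eq_norm_sq_to_K]; push_cast; rfl
  rw [inner_eq_intervalIntegral hR hf hf] at h1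
  have h2 : ∀ t, (starRingEnd ℂ) (u t) * u t = ((‖u t‖ ^ 2 : ℝ) : ℂ) := fun t => by
    rw [Complex.conj_mul']; norm_cast
  simp only [h2] at h1
  rw [intervalIntegral.integral_ofReal] at h1
  exact (Complex.ofReal_injective h1).symm

lemma SolvesAt.isC1Pair_and_integrable (hR : 0 < R)
    (hV : IntervalIntegrable V volume 0 R) {z : ℂ} {f h : SchSp R} {g dg : ℝ → ℂ}
    (hs : SolvesAt R (fun x => (V x : ℂ)) z f h g dg) :
    IsC1Pair R g dg ∧ ∃ h0 : ℝ → ℂ,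
      (∀ᵐ x ∂(volume.restrict (Set.Ioo (0 : ℝ) R)), h x = h0 x) ∧
      IntervalIntegrable h0 volume 0 R ∧
      IntervalIntegrable (fun t => (V t : ℂ) * g t - z * g t - h0 t) volume 0 R ∧
      ∀ x ∈ Set.Icc (0 : ℝ) R,
        dg x = dg 0 + ∫ t in (0 : ℝ)..x, ((V t : ℂ) * g t - z * g t - h0 t) := by
  obtain ⟨-, hd, h0, hh0, hdg⟩ := hs
  have hg : ContinuousOn g (Set.uIcc 0 R) := by
    rw [Set.uIcc_of_le hR.le]
    exact fun x hx => (hd x hx).continuousWithinAt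
  have hVc : IntervalIntegrable (fun t => (V t : ℂ)) volume 0 R := ⟨hV.1.ofReal, hV.2.ofReal⟩
  have hh0i := intervalIntegrable_of_ae_eq_Lp hR hh0
  have hki : IntervalIntegrable (fun t => (V t : ℂ) * g t - z * g t - h0 t) volume 0 R :=
    ((hVc.mul_continuousOn hg).sub (hg.intervalIntegrable.const_mul z)).sub hh0i
  refine ⟨⟨hd, ?_⟩, h0, hh0, hh0i, hki, hdg⟩
  have hc := (absolutelyContinuousOnInterval_integral hki (dg 0)).continuousOn
  rw [Set.uIcc_of_le hR.le] at hc
  exact hc.congr hdg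

/-- The real part of the sesquilinear form of `-d²/dx² + W` with boundary coefficients
`b0`, `bR`. -/
def robinForm (R : ℝ) (W : ℝ → ℝ) (b0 bR : ℝ) (u du v dv : ℝ → ℂ) : ℝ :=
  (∫ x in (0 : ℝ)..R, (inner ℝ (du x) (dv x) + W x * inner ℝ (u x) (v x)))
    + b0 * inner ℝ (u 0) (v 0) + bR * inner ℝ (u R) (v R)

lemma robinForm_integrable (hR : 0 < R) {W : ℝ → ℝ} (hW : IntervalIntegrable W volume 0 R)
    {u du v dv : ℝ → ℂ} (hu : IsC1Pair R u du) (hv : IsC1Pair R v dv) :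
    IntervalIntegrable (fun x => inner ℝ (du x) (dv x) + W x * inner ℝ (u x) (v x))
      volume 0 R := by
  have hucc : Set.uIcc 0 R = Set.Icc 0 R := Set.uIcc_of_le hR.le
  refine IntervalIntegrable.add ?_ (hW.mul_continuousOn ?_)
  · exact ContinuousOn.intervalIntegrable (by rw [hucc]; exact hu.cont.inner hv.cont)
  · rw [hucc]; exact hu.continuousOn.inner hv.continuousOn

lemma robinForm_sub_const_mul (hR : 0 < R) {W : ℝ → ℝ} (hW : IntervalIntegrable W volume 0 R)
    (b0 bR : ℝ) {u du v dv : ℝ → ℂ} (hu : IsC1Pair R u du) (hv : IsC1Pair R v dv) (c : ℝ) :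
    robinForm R W b0 bR (fun x => u x - c * v x) (fun x => du x - c * dv x)
      (fun x => u x - c * v x) (fun x => du x - c * dv x) =
    robinForm R W b0 bR u du u du - 2 * c * robinForm R W b0 bR u du v dv
      + c ^ 2 * robinForm R W b0 bR v dv v dv := by
  have key : ∀ p q : ℂ, (inner ℝ (p - c * q) (p - c * q) : ℝ) =
      inner ℝ p p - 2 * c * inner ℝ p q + c ^ 2 * inner ℝ q q := by
    intro p q
    simp only [Complex.inner, Complex.mul_re, Complex.sub_re, Complex.sub_im, Complex.conj_re,
      Complex.conj_im, Complex.mul_im, Complex.ofReal_re, Complex.ofReal_im]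
    ring
  simp only [robinForm, key]
  have e : ∫ x in (0 : ℝ)..R, (inner ℝ (du x) (du x) - 2 * c * inner ℝ (du x) (dv x)
        + c ^ 2 * inner ℝ (dv x) (dv x) + W x * (inner ℝ (u x) (u x) - 2 * c * inner ℝ (u x) (v x)
        + c ^ 2 * inner ℝ (v x) (v x))) =
      (∫ x in (0 : ℝ)..R, (inner ℝ (du x) (du x) + W x * inner ℝ (u x) (u x)))
      - 2 * c * (∫ x in (0 : ℝ)..R, (inner ℝ (du x) (dv x) + W x * inner ℝ (u x) (v x)))
      + c ^ 2 * ∫ x in (0 : ℝ)..R, (inner ℝ (dv x) (dv x) + W x * inner ℝ (v x) (v x)) := by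
    rw [← intervalIntegral.integral_const_mul, ← intervalIntegral.integral_const_mul,
      ← intervalIntegral.integral_sub (robinForm_integrable hR hW hu hu)
        ((robinForm_integrable hR hW hu hv).const_mul _),
      ← intervalIntegral.integral_add ((robinForm_integrable hR hW hu hu).sub
        ((robinForm_integrable hR hW hu hv).const_mul _))
        ((robinForm_integrable hR hW hv hv).const_mul _)]
    congr 1
    ext x
    ring
  rw [e]
  ring

/-- The form is a relatively bounded perturbation of the Dirichlet energy, uniformly in terms of
the size of the potential and of the boundary coefficients. -/
lemma exists_robinForm_sub_energy_le (hR : 0 < R) (hV : IntervalIntegrable V volume 0 R) (K : ℝ)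
    (hK : 0 ≤ K) :
    ∃ C : ℝ, 0 ≤ C ∧ ∀ (b0 bR : ℝ), (∫ x in (0 : ℝ)..R, |V x|) + |b0| + |bR| ≤ K →
      ∀ (t : ℝ) (u du : ℝ → ℂ), IsC1Pair R u du →
      |robinForm R (fun x => V x - t) b0 bR u du u du
        - ((∫ x in (0 : ℝ)..R, ‖du x‖ ^ 2) - t * ∫ x in (0 : ℝ)..R, ‖u x‖ ^ 2)| ≤
      1 / 2 * (∫ x in (0 : ℝ)..R, ‖du x‖ ^ 2) + C * ∫ x in (0 : ℝ)..R, ‖u x‖ ^ 2 := by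
  refine ⟨K * (1 / R + 2 * (K + 1)), by positivity, fun b0 bR hb t u du hu => ?_⟩
  have hucc : Set.uIcc 0 R = Set.Icc 0 R := Set.uIcc_of_le hR.le
  have huI : IntervalIntegrable (fun t => ‖u t‖ ^ 2) volume 0 R :=
    ContinuousOn.intervalIntegrable (by rw [hucc]; exact hu.continuousOn.norm.pow 2)
  have hduI : IntervalIntegrable (fun t => ‖du t‖ ^ 2) volume 0 R :=
    ContinuousOn.intervalIntegrable (by rw [hucc]; exact hu.cont.norm.pow 2)
  have hVu : IntervalIntegrable (fun x => V x * ‖u x‖ ^ 2) volume 0 R :=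
    hV.mul_continuousOn (by rw [hucc]; exact hu.continuousOn.norm.pow 2)
  set E := ∫ x in (0 : ℝ)..R, ‖du x‖ ^ 2 with hE
  set N := ∫ x in (0 : ℝ)..R, ‖u x‖ ^ 2 with hN
  have hE0 : 0 ≤ E := intervalIntegral.integral_nonneg hR.le fun x _ => by positivity
  have hN0 : 0 ≤ N := intervalIntegral.integral_nonneg hR.le fun x _ => by positivity
  set M := 1 / (2 * (K + 1)) * E + (1 / R + 2 * (K + 1)) * N with hM
  have hM0 : 0 ≤ M := by positivity
  have hsup : ∀ x ∈ Set.Icc 0 R, ‖u x‖ ^ 2 ≤ M := by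
    intro x hx
    have := hu.norm_sq_le hR (ε := 1 / (2 * (K + 1))) (by positivity) hx
    rwa [one_div_one_div] at this
  have hform : robinForm R (fun x => V x - t) b0 bR u du u du - (E - t * N) =
      (∫ x in (0 : ℝ)..R, V x * ‖u x‖ ^ 2) + b0 * ‖u 0‖ ^ 2 + bR * ‖u R‖ ^ 2 := by
    simp only [robinForm, real_inner_self_eq_norm_sq]
    have : ∫ x in (0 : ℝ)..R, (‖du x‖ ^ 2 + (V x - t) * ‖u x‖ ^ 2) =
        E + (∫ x in (0 : ℝ)..R, V x * ‖u x‖ ^ 2) - t * N := by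
      rw [hE, hN, ← intervalIntegral.integral_const_mul,
        ← intervalIntegral.integral_add hduI hVu,
        ← intervalIntegral.integral_sub (hduI.add hVu) (huI.const_mul t)]
      congr 1
      ext x
      ring
    rw [this]
    ring
  have h1 : |∫ x in (0 : ℝ)..R, V x * ‖u x‖ ^ 2| ≤ (∫ x in (0 : ℝ)..R, |V x|) * M := by
    rw [← intervalIntegral.integral_mul_const]
    refine (intervalIntegral.abs_integral_le_integral_abs hR.le).trans ?_
    refine intervalIntegral.integral_mono_on hR.le hVu.abs (hV.abs.mul_const M) fun x hx => ?_
    rw [abs_mul, abs_of_nonneg (by positivity : 0 ≤ ‖u x‖ ^ 2)]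
    exact mul_le_mul_of_nonneg_left (hsup x hx) (abs_nonneg _)
  have h2 : ∀ b x, x ∈ Set.Icc 0 R → |b * ‖u x‖ ^ 2| ≤ |b| * M := fun b x hx => by
    rw [abs_mul, abs_of_nonneg (by positivity : 0 ≤ ‖u x‖ ^ 2)]
    exact mul_le_mul_of_nonneg_left (hsup x hx) (abs_nonneg _)
  rw [hform]
  have h3 := abs_add_three (∫ x in (0 : ℝ)..R, V x * ‖u x‖ ^ 2) (b0 * ‖u 0‖ ^ 2)
    (bR * ‖u R‖ ^ 2)
  have h4 := h2 b0 0 (by simp [hR.le])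
  have h5 := h2 bR R (by simp [hR.le])
  have h6 : ((∫ x in (0 : ℝ)..R, |V x|) + |b0| + |bR|) * M ≤ K * M :=
    mul_le_mul_of_nonneg_right hb hM0
  have h7 : K * M ≤ 1 / 2 * E + K * (1 / R + 2 * (K + 1)) * N := by
    have : K * (1 / (2 * (K + 1))) ≤ 1 / 2 := by
      rw [mul_one_div, div_le_div_iff₀ (by positivity) (by norm_num)]
      linarith
    have := mul_le_mul_of_nonneg_right this hE0
    rw [hM]
    linarith
  linarith

/-- Green's formula. -/
lemma SolvesAt.re_inner_eq_robinForm (hR : 0 < R) (hV : IntervalIntegrable V volume 0 R)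
    {f h k : SchSp R} {g dg u du : ℝ → ℂ} (hs : SolvesAt R (fun x => (V x : ℂ)) 0 f h g dg)
    (hk : ∀ᵐ x ∂(volume.restrict (Set.Ioo (0 : ℝ) R)), k x = u x) (hu : IsC1Pair R u du)
    {b0 bR : ℝ} (h0 : (starRingEnd ℂ) (u 0) * dg 0 = b0 * ((starRingEnd ℂ) (u 0) * g 0))
    (hbR : (starRingEnd ℂ) (u R) * dg R = -bR * ((starRingEnd ℂ) (u R) * g R)) (t : ℝ) :
    (⟪k, h - (t : ℂ) • f⟫_ℂ).re = robinForm R (fun x => V x - t) b0 bR u du g dg := by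
  obtain ⟨hg, w, hw, hwi, hli, hdg⟩ := hs.isC1Pair_and_integrable hR hV
  have hucc : Set.uIcc 0 R = Set.Icc 0 R := Set.uIcc_of_le hR.le
  have hdu : IntervalIntegrable (fun x => (starRingEnd ℂ) (du x)) volume 0 R :=
    ContinuousOn.intervalIntegrable (by rw [hucc]; exact hu.conj.cont)
  have green := integral_mul_add_mul_of_primitives hR.le hdu hli
    (U := fun x => (starRingEnd ℂ) (u x)) (W := dg)
    (fun x hx => hu.conj.eq_add_integral hx) hdg
  have hsol : ∀ᵐ x ∂(volume.restrict (Set.Ioo (0 : ℝ) R)),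
      (h - (t : ℂ) • f : SchSp R) x = w x - t * g x := by
    filter_upwards [Lp.coeFn_sub h ((t : ℂ) • f), Lp.coeFn_smul (t : ℂ) f, hw, hs.1]
      with x h1 h2 h3 h4
    rw [h1, Pi.sub_apply, h2, Pi.smul_apply, h3, h4, smul_eq_mul]
  rw [inner_eq_intervalIntegral hR hk hsol]
  have hA : IntervalIntegrable (fun x => (starRingEnd ℂ) (u x) * (w x - t * g x)) volume 0 R :=
    (hwi.sub ((ContinuousOn.intervalIntegrable
      (by rw [hucc]; exact hg.continuousOn)).const_mul (t : ℂ))).continuousOn_mul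
      (by rw [hucc]; exact hu.conj.continuousOn)
  have hB : IntervalIntegrable (fun x => (starRingEnd ℂ) (du x) * dg x +
      (starRingEnd ℂ) (u x) * ((V x : ℂ) * g x - 0 * g x - w x)) volume 0 R :=
    (hdu.mul_continuousOn (by rw [hucc]; exact hg.cont)).add
      (hli.continuousOn_mul (by rw [hucc]; exact hu.conj.continuousOn))
  have hsum : (∫ x in (0 : ℝ)..R, (starRingEnd ℂ) (u x) * (w x - t * g x)) +
      ((starRingEnd ℂ) (u R) * dg R - (starRingEnd ℂ) (u 0) * dg 0) =
      ∫ x in (0 : ℝ)..R, ((starRingEnd ℂ) (u x) * (w x - t * g x) +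
        ((starRingEnd ℂ) (du x) * dg x +
          (starRingEnd ℂ) (u x) * ((V x : ℂ) * g x - 0 * g x - w x))) := by
    rw [intervalIntegral.integral_add hA hB, green]
  have hre := congrArg Complex.re hsum
  have hswap := intervalIntegral.intervalIntegral_re (𝕜 := ℂ) (hA.add hB)
  have hint : ∀ x, RCLike.re ((starRingEnd ℂ) (u x) * (w x - t * g x) +
        ((starRingEnd ℂ) (du x) * dg x +
          (starRingEnd ℂ) (u x) * ((V x : ℂ) * g x - 0 * g x - w x))) =
      inner ℝ (du x) (dg x) + (V x - t) * inner ℝ (u x) (g x) := by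
    intro x
    simp [Complex.inner]
    ring
  simp only [hint] at hswap
  rw [robinForm, hswap]
  refine Eq.trans ?_ (congrArg₂ (· + ·) (congrArg₂ (· + ·) hre rfl) rfl)
  rw [h0, hbR]
  simp [Complex.inner]
  ring

end Schrodinger

section SchrodingerOperators

variable {R : ℝ} {V : ℝ → ℝ}

lemma SolvesAt.add (hR : 0 < R) (hV : IntervalIntegrable V volume 0 R) {z : ℂ}
    {f h f' h' : SchSp R} {g dg g' dg' : ℝ → ℂ}
    (hs : SolvesAt R (fun x => (V x : ℂ)) z f h g dg)
    (hs' : SolvesAt R (fun x => (V x : ℂ)) z f' h' g' dg') :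
    SolvesAt R (fun x => (V x : ℂ)) z (f + f') (h + h') (fun x => g x + g' x)
      (fun x => dg x + dg' x) := by
  obtain ⟨hg, w, hw, -, hli, hdg⟩ := hs.isC1Pair_and_integrable hR hV
  obtain ⟨hg', w', hw', -, hli', hdg'⟩ := hs'.isC1Pair_and_integrable hR hV
  refine ⟨?_, fun x hx => (hg.hasDeriv x hx).add (hg'.hasDeriv x hx),
    fun x => w x + w' x, ?_, fun x hx => ?_⟩
  · filter_upwards [Lp.coeFn_add f f', hs.1, hs'.1] with x h1 h2 h3
    rw [h1, Pi.add_apply, h2, h3]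
  · filter_upwards [Lp.coeFn_add h h', hw, hw'] with x h1 h2 h3
    rw [h1, Pi.add_apply, h2, h3]
  · have hsub : Set.uIcc 0 x ⊆ Set.uIcc 0 R := by
      rw [Set.uIcc_of_le hx.1, Set.uIcc_of_le hR.le]
      exact Set.Icc_subset_Icc_right hx.2
    have e := intervalIntegral.integral_add (hli.mono_set hsub) (hli'.mono_set hsub)
    change dg x + dg' x = (dg 0 + dg' 0) + _
    rw [hdg x hx, hdg' x hx, add_add_add_comm, ← e]
    congr 2
    ext t
    ring

lemma SolvesAt.const_smul {z : ℂ} {f h : SchSp R} {g dg : ℝ → ℂ} {V : ℝ → ℂ}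
    (hs : SolvesAt R V z f h g dg) (c : ℂ) :
    SolvesAt R V z (c • f) (c • h) (fun x => c * g x) (fun x => c * dg x) := by
  obtain ⟨hf, hd, w, hw, hdg⟩ := hs
  refine ⟨?_, fun x hx => (hd x hx).const_mul c, fun x => c * w x, ?_, fun x hx => ?_⟩
  · filter_upwards [Lp.coeFn_smul c f, hf] with x h1 h2
    rw [h1, Pi.smul_apply, h2, smul_eq_mul]
  · filter_upwards [Lp.coeFn_smul c h, hw] with x h1 h2
    rw [h1, Pi.smul_apply, h2, smul_eq_mul]
  · change c * dg x = c * dg 0 + _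
    rw [hdg x hx, mul_add, ← intervalIntegral.integral_const_mul]
    congr 2
    ext t
    ring

lemma bdryC_add (t0 tR : ℂ) (g dg g' dg' : ℝ → ℂ) :
    bdryC R t0 tR (fun x => g x + g' x) (fun x => dg x + dg' x) =
      bdryC R t0 tR g dg + bdryC R t0 tR g' dg' := by
  ext i
  fin_cases i <;> simp [bdryC] <;> ring

lemma bdryC_const_mul (t0 tR c : ℂ) (g dg : ℝ → ℂ) :
    bdryC R t0 tR (fun x => c * g x) (fun x => c * dg x) = c • bdryC R t0 tR g dg := by
  ext i
  fin_cases i <;> simp [bdryC] <;> ring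

/-- The coefficient of a Robin boundary condition in the quadratic form (zero for Dirichlet
conditions). -/
def robinCoeff (θ : ℝ) : ℝ := -(Real.cos θ / Real.sin θ)

lemma eq_robinCoeff_mul {θ : ℝ} (hθ : Real.sin θ ≠ 0) {a b : ℂ}
    (h : Complex.cos θ * a + Complex.sin θ * b = 0) : b = robinCoeff θ * a := by
  have hθ' : Complex.sin θ ≠ 0 := by
    rw [← Complex.ofReal_sin]; exact_mod_cast hθ
  rw [robinCoeff]
  push_cast
  field_simp
  linear_combination h

lemma conj_mul_eq_robinCoeff_mul {θ : ℝ} {a b : ℂ}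
    (h : Complex.cos θ * a + Complex.sin θ * b = 0) :
    (starRingEnd ℂ) a * b = robinCoeff θ * ((starRingEnd ℂ) a * a) := by
  by_cases hθ : Real.sin θ = 0
  · have hc : Real.cos θ ≠ 0 := by
      intro hc
      have := Real.sin_sq_add_cos_sq θ
      rw [hθ, hc] at this
      norm_num at this
    have hc' : Complex.cos θ ≠ 0 := by
      rw [← Complex.ofReal_cos]; exact_mod_cast hc
    rw [← Complex.ofReal_sin, hθ] at h
    have ha : a = 0 := by simpa [hc'] using h
    simp [ha]
  · rw [eq_robinCoeff_mul hθ h]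
    ring

lemma bdryC_eq_zero_iff {t0 tR : ℂ} {g dg : ℝ → ℂ} :
    bdryC R t0 tR g dg = 0 ↔ Complex.cos t0 * g 0 + Complex.sin t0 * dg 0 = 0 ∧
      Complex.cos tR * g R + Complex.sin tR * (-dg R) = 0 := by
  rw [funext_iff, Fin.forall_fin_two]
  simp [bdryC, sub_eq_add_neg]

lemma SolvesAt.re_inner_self_eq (hR : 0 < R) (hV : IntervalIntegrable V volume 0 R)
    {f h : SchSp R} {g dg : ℝ → ℂ} {t0 tR : ℝ}
    (hs : SolvesAt R (fun x => (V x : ℂ)) 0 f h g dg) (hb : bdryC R t0 tR g dg = 0) (t : ℝ) :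
    (⟪f, h - (t : ℂ) • f⟫_ℂ).re =
      robinForm R (fun x => V x - t) (robinCoeff t0) (robinCoeff tR) g dg g dg := by
  obtain ⟨h0, hbR⟩ := bdryC_eq_zero_iff.1 hb
  refine hs.re_inner_eq_robinForm hR hV hs.1 (hs.isC1Pair_and_integrable hR hV).1
    (conj_mul_eq_robinCoeff_mul h0) ?_ t
  linear_combination -conj_mul_eq_robinCoeff_mul hbR

lemma SolvesAt.re_inner_eq (hR : 0 < R) (hV : IntervalIntegrable V volume 0 R)
    {f h k : SchSp R} {g dg u du : ℝ → ℂ} {t0 tR : ℝ}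
    (hs : SolvesAt R (fun x => (V x : ℂ)) 0 f h g dg) (hb : bdryC R t0 tR g dg = 0)
    (ht0 : Real.sin t0 ≠ 0) (htR : Real.sin tR ≠ 0)
    (hk : ∀ᵐ x ∂(volume.restrict (Set.Ioo (0 : ℝ) R)), k x = u x) (hu : IsC1Pair R u du) (t : ℝ) :
    (⟪k, h - (t : ℂ) • f⟫_ℂ).re =
      robinForm R (fun x => V x - t) (robinCoeff t0) (robinCoeff tR) u du g dg := by
  obtain ⟨h0, hbR⟩ := bdryC_eq_zero_iff.1 hb
  refine hs.re_inner_eq_robinForm hR hV hk hu ?_ ?_ t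
  · rw [eq_robinCoeff_mul ht0 h0]; ring
  · linear_combination -((starRingEnd ℂ) (u R)) * eq_robinCoeff_mul htR hbR

lemma IsSchrodingerOp.exists_solvesAt_res {t0 tR : ℂ} {V : ℝ → ℂ} {A : SchSp R →ₗ.[ℂ] SchSp R}
    (hA : IsSchrodingerOp R V t0 tR A) {z : ℂ} (hz : z ∈ resolventSetP A) (x : SchSp R) :
    ∃ g dg : ℝ → ℂ, SolvesAt R V 0 (res A z x) (x + z • res A z x) g dg ∧
      bdryC R t0 tR g dg = 0 := by
  obtain ⟨hx, h⟩ := (isResolvent_res hz).1 x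
  refine (hA _ _).1 ((LinearPMap.mem_graph_iff A).2 ⟨⟨_, hx⟩, rfl, sub_eq_iff_eq_add.1 h⟩)

lemma IsSchrodingerOp.exists_lower_bound (hR : 0 < R) (hV : IntervalIntegrable V volume 0 R)
    {t0 tR : ℝ} {A : SchSp R →ₗ.[ℂ] SchSp R}
    (hA : IsSchrodingerOp R (fun x => (V x : ℂ)) t0 tR A) :
    ∃ C : ℝ, ∀ (t : ℝ) (u : A.domain),
      (-t - C) * ‖(u : SchSp R)‖ ^ 2 ≤ (⟪(u : SchSp R), A u - (t : ℂ) • (u : SchSp R)⟫_ℂ).re := by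
  have hK : 0 ≤ (∫ x in (0 : ℝ)..R, |V x|) + |robinCoeff t0| + |robinCoeff tR| := by
    have : 0 ≤ ∫ x in (0 : ℝ)..R, |V x| :=
      intervalIntegral.integral_nonneg hR.le fun x _ => abs_nonneg _
    positivity
  obtain ⟨C, -, hC⟩ := exists_robinForm_sub_energy_le hR hV _ hK
  refine ⟨C, fun t u => ?_⟩
  obtain ⟨g, dg, hs, hb⟩ := (hA _ _).1 (LinearPMap.mem_graph A u)
  have h1 := hC _ _ le_rfl t g dg (hs.isC1Pair_and_integrable hR hV).1
  rw [hs.re_inner_self_eq hR hV hb, norm_sq_eq_intervalIntegral hR hs.1]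
  have hE : 0 ≤ ∫ x in (0 : ℝ)..R, ‖dg x‖ ^ 2 :=
    intervalIntegral.integral_nonneg hR.le fun x _ => by positivity
  have h2 := (abs_le.1 h1).1
  linarith

lemma IsSchrodingerOp.bddBelow_specP (hR : 0 < R) (hV : IntervalIntegrable V volume 0 R)
    {t0 tR : ℝ} {A : SchSp R →ₗ.[ℂ] SchSp R}
    (hA : IsSchrodingerOp R (fun x => (V x : ℂ)) t0 tR A) (hsa : IsSelfAdjoint A) :
    BddBelow {x : ℝ | (x : ℂ) ∈ specP A} := by
  obtain ⟨C, hC⟩ := hA.exists_lower_bound hR hV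
  refine ⟨-C, fun x hx => ?_⟩
  by_contra! hlt
  exact hx (hsa.mem_resolventSetP_of_lower_bound (δ := -x - C) (by linarith) (hC x))

/-- The resolvent of a Schrödinger operator with arbitrary separated boundary conditions is
dominated, in the sense of forms, by the resolvent for non-Dirichlet boundary conditions. -/
lemma IsSchrodingerOp.exists_res_comparison (hR : 0 < R) (hV : IntervalIntegrable V volume 0 R)
    {t0 tR t0' tR' : ℝ} {A A' : SchSp R →ₗ.[ℂ] SchSp R}
    (hA : IsSchrodingerOp R (fun x => (V x : ℂ)) t0 tR A)
    (hA' : IsSchrodingerOp R (fun x => (V x : ℂ)) t0' tR' A')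
    (ht0' : Real.sin t0' ≠ 0) (htR' : Real.sin tR' ≠ 0) :
    ∃ s : ℝ, ∀ t : ℝ, t ≤ s → (t : ℂ) ∈ resolventSetP A → (t : ℂ) ∈ resolventSetP A' →
      ∀ x : SchSp R, (⟪x, res A t x⟫_ℂ).re ≤ 3 * (⟪x, res A' t x⟫_ℂ).re := by
  have hV0 : 0 ≤ ∫ x in (0 : ℝ)..R, |V x| :=
    intervalIntegral.integral_nonneg hR.le fun x _ => abs_nonneg _
  obtain ⟨C, hC0, hC⟩ := exists_robinForm_sub_energy_le hR hV
    ((∫ x in (0 : ℝ)..R, |V x|) + |robinCoeff t0| + |robinCoeff tR| + |robinCoeff t0'|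
      + |robinCoeff tR'|) (by positivity)
  refine ⟨-2 * C, fun t ht hz hz' x => ?_⟩
  have hVt : IntervalIntegrable (fun x => V x - t) volume 0 R := hV.sub intervalIntegrable_const
  obtain ⟨f, df, hf, hbf⟩ := hA.exists_solvesAt_res hz x
  obtain ⟨g, dg, hg, hbg⟩ := hA'.exists_solvesAt_res hz' x
  have cf := (hf.isC1Pair_and_integrable hR hV).1
  have cg := (hg.isC1Pair_and_integrable hR hV).1
  have e1 := hf.re_inner_self_eq hR hV hbf t
  have e2 := hg.re_inner_self_eq hR hV hbg t
  have e3 := hg.re_inner_eq hR hV hbg ht0' htR' hf.1 cf t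
  rw [add_sub_cancel_right] at e1 e2 e3
  have hC' := hC (robinCoeff t0') (robinCoeff tR') (by
    have := abs_nonneg (robinCoeff t0); have := abs_nonneg (robinCoeff tR); linarith) t
  have e4 := hC (robinCoeff t0) (robinCoeff tR) (by
    have := abs_nonneg (robinCoeff t0'); have := abs_nonneg (robinCoeff tR'); linarith) t f df cf
  have e5 := hC' f df cf
  have e6 := hC' _ _ (cf.sub_const_mul cg ((3 : ℝ) : ℂ))
  rw [robinForm_sub_const_mul hR hVt _ _ cf cg] at e6
  have hN : ∀ u : ℝ → ℂ, 0 ≤ ∫ x in (0 : ℝ)..R, ‖u x‖ ^ 2 := fun u =>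
    intervalIntegral.integral_nonneg hR.le fun x _ => by positivity
  have hEf := hN df
  have hNf := hN f
  have hE3 := hN fun x => df x - ((3 : ℝ) : ℂ) * dg x
  have hN3 := hN fun x => f x - ((3 : ℝ) : ℂ) * g x
  have e4' := (abs_le.1 e4).1
  have e5' := (abs_le.1 e5).2
  have e6' := (abs_le.1 e6).1
  have m1 : 0 ≤ (-t - 2 * C) * ∫ x in (0 : ℝ)..R, ‖f x‖ ^ 2 := mul_nonneg (by linarith) hNf
  have m2 : 0 ≤ (-t - C) * ∫ x in (0 : ℝ)..R, ‖f x - ((3 : ℝ) : ℂ) * g x‖ ^ 2 :=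
    mul_nonneg (by linarith) hN3
  have s1 : (⟪x, res A t x⟫_ℂ).re = (⟪res A t x, x⟫_ℂ).re := inner_re_symm (𝕜 := ℂ) _ _
  have s2 : (⟪x, res A' t x⟫_ℂ).re = (⟪res A' t x, x⟫_ℂ).re := inner_re_symm (𝕜 := ℂ) _ _
  rw [s1, s2]
  linarith

/-- The difference of the resolvents of two Schrödinger operators with separated boundary
conditions has rank at most two. -/
lemma IsSchrodingerOp.not_linearIndependent_res_sub_res (hR : 0 < R)
    (hV : IntervalIntegrable V volume 0 R) {t0 tR t0' tR' : ℂ} {A A' : SchSp R →ₗ.[ℂ] SchSp R}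
    (hA : IsSchrodingerOp R (fun x => (V x : ℂ)) t0 tR A)
    (hA' : IsSchrodingerOp R (fun x => (V x : ℂ)) t0' tR' A') {z : ℂ}
    (hz : z ∈ resolventSetP A) (hz' : z ∈ resolventSetP A') (x : Fin 3 → SchSp R) :
    ¬ LinearIndependent ℂ fun i => (res A' z - res A z) (x i) := by
  choose g dg hs hb using fun i => hA.exists_solvesAt_res hz (x i)
  have hdep : ¬ LinearIndependent ℂ fun i => bdryC R t0' tR' (g i) (dg i) := fun hli => by
    have := hli.fintype_card_le_finrank
    simp at this
  rw [Fintype.not_linearIndependent_iff] at hdep ⊢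
  obtain ⟨c, hc, hne⟩ := hdep
  refine ⟨c, ?_, hne⟩
  have hsum := (((hs 0).const_smul (c 0)).add hR hV ((hs 1).const_smul (c 1))).add hR hV
    ((hs 2).const_smul (c 2))
  have hgr := (hA' _ _).2 ⟨_, _, hsum, by
    rw [bdryC_add, bdryC_add, bdryC_const_mul, bdryC_const_mul, bdryC_const_mul, ← hc,
      Fin.sum_univ_three]⟩
  obtain ⟨u, hu1, hu2⟩ := (LinearPMap.mem_graph_iff A').1 hgr
  have key := (isResolvent_res hz').2 u
  rw [hu1, hu2] at key
  have harg : c 0 • (x 0 + z • res A z (x 0)) + c 1 • (x 1 + z • res A z (x 1))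
      + c 2 • (x 2 + z • res A z (x 2)) - z • (c 0 • res A z (x 0) + c 1 • res A z (x 1)
      + c 2 • res A z (x 2)) = c 0 • x 0 + c 1 • x 1 + c 2 • x 2 := by
    module
  rw [harg] at key
  simp only [map_add, map_smul] at key
  simp only [Fin.sum_univ_three, sub_apply, smul_sub]
  rw [← sub_eq_zero] at key
  rw [← key]
  module

end SchrodingerOperators

/-- Two inverse square root families are related by a bounded factor when their generators'
resolvents are comparable as forms. -/
lemma IsInvSqrtFamily.exists_comp_eq {A A' : H →ₗ.[ℂ] H} {c c' : ℝ} {N N' : ℂ → (H →L[ℂ] H)}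
    (hN : IsInvSqrtFamily A c N) (hN' : IsInvSqrtFamily A' c' N') {z : ℂ} (hz : z ∈ offCut c)
    (hz' : z ∈ offCut c') {t K : ℝ} (ht : t < c) (ht' : t < c') (hK : 0 ≤ K)
    (h : ∀ x, (⟪x, res A t x⟫_ℂ).re ≤ K * (⟪x, res A' t x⟫_ℂ).re) :
    ∃ T : H →L[ℂ] H, (N' z).comp T = N z := by
  obtain ⟨C, hC, h1⟩ := hN.exists_norm_sq_comparison (conj_mem_offCut hz) ht
  obtain ⟨C', hC', h2⟩ := hN'.exists_norm_sq_comparison (conj_mem_offCut hz') ht'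
  refine exists_comp_eq_of_norm_adjoint_le (hN'.injective hz') (C := √(C * (K * C')))
    fun x => ?_
  rw [hN.adjoint_apply hz, hN'.adjoint_apply hz']
  refine (sq_le_sq₀ (norm_nonneg _) (by positivity)).1 ?_
  rw [mul_pow, Real.sq_sqrt (by positivity), mul_assoc, mul_assoc]
  exact (h1 x).1.trans (mul_le_mul_of_nonneg_left
    ((h x).trans (mul_le_mul_of_nonneg_left (h2 x).2 hK)) hC)

lemma nontrivial_schSp {R : ℝ} (hR : 0 < R) : Nontrivial (SchSp R) := by
  refine ⟨indicatorConstLp 2 MeasurableSet.univ (measure_ne_top _ _) (1 : ℂ), 0, fun h => ?_⟩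
  have h1 := congrArg norm h
  rw [norm_indicatorConstLp (by norm_num) (by norm_num), norm_zero] at h1
  have h2 : (volume.restrict (Set.Ioo (0 : ℝ) R)).real Set.univ = R := by
    simp [hR.le]
  rw [h2, norm_one, one_mul] at h1
  exact (Real.rpow_pos_of_pos hR _).ne' h1

lemma offCut_einf1_subset {R : ℝ} {A : SchSp R →ₗ.[ℂ] SchSp R} (hA : IsSelfAdjoint A)
    (hb : BddBelow {x : ℝ | (x : ℂ) ∈ specP A}) : offCut (einf1 R A) ⊆ resolventSetP A := by
  intro z hz
  by_cases him : z.im = 0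
  · have hre : z.re < einf1 R A := hz.resolve_left (not_not.2 him)
    have h : ((z.re : ℝ) : ℂ) ∉ specP A := notMem_of_lt_csInf (s := {x : ℝ | (x : ℂ) ∈ specP A})
      hre hb
    have hzr : ((z.re : ℝ) : ℂ) = z := Complex.ext (by simp) (by simp [him])
    rw [hzr] at h
    exact not_not.1 h
  · exact hA.mem_resolventSetP_of_im_ne_zero him

lemma IsSqrtResFam.isInvSqrtFamily {R : ℝ} {A : SchSp R →ₗ.[ℂ] SchSp R}
    {N : ℂ → (SchSp R →L[ℂ] SchSp R)} (hN : IsSqrtResFam R A (einf1 R A) N)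
    (hA : IsSelfAdjoint A) (hb : BddBelow {x : ℝ | (x : ℂ) ∈ specP A}) :
    IsInvSqrtFamily A (einf1 R A) N where
  mem_res := offCut_einf1_subset hA hb
  sq := hN.1
  nonneg := fun x hx => by
    obtain ⟨hs, hp⟩ := hN.2.1 x hx
    rw [ContinuousLinearMap.nonneg_iff_isPositive, ContinuousLinearMap.isPositive_def]
    refine ⟨hs, fun v => ?_⟩
    rw [ContinuousLinearMap.reApplyInnerSelf_apply, hs]
    exact hp v
  diff := hN.2.2

/-- for real `V` and `z ∈ ℂ \ [e₀,∞)`, the symmetrized product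
`D = closure((H' - z)^{1/2}(H - z)⁻¹(H' - z)^{1/2})` (characterized by
`(H' - z)^{-1/2} D (H' - z)^{-1/2} = (H - z)⁻¹`) is bounded, equals
`[(H' - z)^{1/2}(H - z)^{-1/2}]·[(H' - z̄)^{1/2}(H - z̄)^{-1/2}]*`, and `I - D` has rank
at most two (in particular is trace class). -/
theorem statement11
    (Rr : ℝ) (hR : 0 < Rr) (V : ℝ → ℝ)
    (hV : MeasureTheory.IntegrableOn V (Set.Ioo 0 Rr) MeasureTheory.volume)
    (t0 tR t0' tR' : ℝ)
    (ht0 : t0 ∈ Set.Ico 0 (2 * Real.pi)) (htR : tR ∈ Set.Ico 0 (2 * Real.pi))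
    (ht0' : t0' ∈ Set.Ioo 0 (2 * Real.pi) ∧ t0' ≠ Real.pi)
    (htR' : tR' ∈ Set.Ioo 0 (2 * Real.pi) ∧ tR' ≠ Real.pi)
    (Hop Hop' : SchSp Rr →ₗ.[ℂ] SchSp Rr)
    (hHop : IsSchrodingerOp Rr (fun x => (V x : ℂ)) (t0 : ℂ) (tR : ℂ) Hop)
    (hHop' : IsSchrodingerOp Rr (fun x => (V x : ℂ)) (t0' : ℂ) (tR' : ℂ) Hop')
    (hsa : IsSelfAdjoint Hop) (hsa' : IsSelfAdjoint Hop')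
    (NH NH' : ℂ → (SchSp Rr →L[ℂ] SchSp Rr))
    (hNH : IsSqrtResFam Rr Hop (einf1 Rr Hop) NH)
    (hNH' : IsSqrtResFam Rr Hop' (einf1 Rr Hop') NH')
    (z : ℂ) (hz : z ∈ offCut (einf Rr Hop Hop')) :
    ∃ D T1 T2 : SchSp Rr →L[ℂ] SchSp Rr,
      (NH' z).comp (D.comp (NH' z)) = res Hop z ∧
      (NH' z).comp T1 = NH z ∧
      (NH' ((starRingEnd ℂ) z)).comp T2 = NH ((starRingEnd ℂ) z) ∧
      D = T1.comp (ContinuousLinearMap.adjoint T2) ∧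
      (∃ (y1 y2 : SchSp Rr) (p1 p2 : SchSp Rr →L[ℂ] ℂ),
        ∀ x : SchSp Rr, ((1 : SchSp Rr →L[ℂ] SchSp Rr) - D) x = p1 x • y1 + p2 x • y2) ∧
      IsTraceClass ((1 : SchSp Rr →L[ℂ] SchSp Rr) - D) := by
  have hVi : IntervalIntegrable V volume 0 Rr := by
    rwa [intervalIntegrable_iff_integrableOn_Ioo_of_le hR.le]
  have sin_ne : ∀ θ : ℝ, θ ∈ Set.Ioo 0 (2 * Real.pi) → θ ≠ Real.pi → Real.sin θ ≠ 0 := by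
    intro θ hθ hne
    rcases lt_or_gt_of_ne hne with h | h
    · exact (Real.sin_pos_of_pos_of_lt_pi hθ.1 h).ne'
    · have := Real.sin_pos_of_pos_of_lt_pi (x := θ - Real.pi) (by linarith) (by linarith [hθ.2])
      rw [Real.sin_sub_pi] at this
      linarith
  have := nontrivial_schSp hR
  have hb := hHop.bddBelow_specP hR hVi hsa
  have hb' := hHop'.bddBelow_specP hR hVi hsa'
  have hN := hNH.isInvSqrtFamily hsa hb
  have hN' := hNH'.isInvSqrtFamily hsa' hb'
  have hbu : BddBelow {x : ℝ | (x : ℂ) ∈ specP Hop ∪ specP Hop'} := hb.union hb'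
  have hle : einf Rr Hop Hop' ≤ einf1 Rr Hop :=
    csInf_le_csInf hbu hsa.exists_real_mem_specP fun x hx => Or.inl hx
  have hle' : einf Rr Hop Hop' ≤ einf1 Rr Hop' :=
    csInf_le_csInf hbu hsa'.exists_real_mem_specP fun x hx => Or.inr hx
  obtain ⟨s, hs⟩ := hHop.exists_res_comparison hR hVi hHop' (sin_ne t0' ht0'.1 ht0'.2)
    (sin_ne tR' htR'.1 htR'.2)
  set t := min s (einf Rr Hop Hop' - 1) with ht
  have hte : t < einf Rr Hop Hop' := (min_le_right _ _).trans_lt (by linarith)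
  have htc := hte.trans_le hle
  have htc' := hte.trans_le hle'
  have hcmp := hs t (min_le_left _ _) (hN.mem_res (ofReal_mem_offCut htc))
    (hN'.mem_res (ofReal_mem_offCut htc'))
  have hzc := offCut_mono hle hz
  have hzc' := offCut_mono hle' hz
  obtain ⟨T1, h1⟩ := hN.exists_comp_eq hN' hzc hzc' htc htc' (by norm_num) hcmp
  obtain ⟨T2, h2⟩ := hN.exists_comp_eq hN' (conj_mem_offCut hzc) (conj_mem_offCut hzc') htc htc'
    (by norm_num) hcmp
  have h2' : (ContinuousLinearMap.adjoint T2).comp (NH' z) = NH z := by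
    have := congrArg ContinuousLinearMap.adjoint h2
    rwa [ContinuousLinearMap.adjoint_comp, hN'.adjoint_apply (conj_mem_offCut hzc'),
      hN.adjoint_apply (conj_mem_offCut hzc), Complex.conj_conj] at this
  have hD : (NH' z).comp ((T1.comp (ContinuousLinearMap.adjoint T2)).comp (NH' z)) =
      res Hop z := by
    rw [ContinuousLinearMap.comp_assoc, h2', ← ContinuousLinearMap.comp_assoc, h1]
    exact hN.sq z hzc
  have hF : (NH' z).comp (((1 : SchSp Rr →L[ℂ] SchSp Rr) -
      T1.comp (ContinuousLinearMap.adjoint T2)).comp (NH' z)) = res Hop' z - res Hop z := by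
    rw [ContinuousLinearMap.sub_comp, ContinuousLinearMap.comp_sub, hD]
    exact congrArg (· - res Hop z) (hN'.sq z hzc')
  obtain ⟨y1, y2, p1, p2, hrank⟩ := exists_rank_two_of_sandwich (hN'.injective hzc')
    (hN'.denseRange hzc') hF (hHop.not_linearIndependent_res_sub_res hR hVi hHop'
      (hN.mem_res hzc) (hN'.mem_res hzc'))
  exact ⟨_, T1, T2, hD, h1, h2, rfl, ⟨y1, y2, p1, p2, hrank⟩, isTraceClass_of_rank_two hrank⟩

end
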